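/- arXiv:math/0406286 — 4 statements merged into one kernel-verified Lean document; each statement's English description precedes it below -/
import Mathlib

section
/- Let R be a Noetherian commutative ring, B a finitely generated commutative R-algebra, and A an R-subalgebra of B such that the inclusion A → B is pure. Then A is a finitely generated R-algebra. -/
open scoped TensorProduct

universe u


theorem PureFT.finiteType_of_noeth {Q C : Type*} [CommRing Q] [CommRing C] [Algebra Q C]
    [IsNoetherianRing C] (t : Q)
    (h1 : ∀ c : C, ∃ (n : ℕ) (q : Q), algebraMap Q C t ^ n * c = algebraMap Q C q)
    (h2 : ∀ c : C, ∃ q : Q, ∀ n : ℕ, ∃ c' : C, c - algebraMap Q C q = algebraMap Q C t ^ n * c') :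
    Algebra.FiniteType Q C := by
  classical
  set f := algebraMap Q C t with hf
  let J : Ideal C := ⨅ i : ℕ, Ideal.span {f} ^ i • ⊤
  obtain ⟨s, hs⟩ : J.FG := IsNoetherian.noetherian J
  have hr : ∀ j : C, ∃ r : C, j ∈ J → r * f * j = j := by
    intro j
    by_cases hj : j ∈ J
    · have := (Ideal.mem_iInf_smul_pow_eq_bot_iff (Ideal.span {f}) j).1 hj
      obtain ⟨⟨r, hr⟩, h⟩ := this
      obtain ⟨a, rfl⟩ := Ideal.mem_span_singleton'.1 hr
      exact ⟨a, fun _ => h⟩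
    · exact ⟨0, fun h => absurd h hj⟩
  choose r hr using hr
  let T : Subalgebra Q C := Algebra.adjoin Q ((s ∪ s.image r : Finset C) : Set C)
  have hJ : ∀ j ∈ J, ∀ c : C, c * j ∈ T := by
    intro j hj
    rw [← hs] at hj
    induction hj using Submodule.span_induction with
    | mem x hx =>
      intro c
      have hxJ : x ∈ J := hs ▸ Submodule.subset_span hx
      have hrx := hr x hxJ
      obtain ⟨n, q, hq⟩ := h1 c
      have hpow : ∀ n : ℕ, (r x * f) ^ n * x = x := by
        intro n
        induction n with
        | zero => simp
        | succ n ih => rw [pow_succ, mul_assoc, hrx, ih]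
      have : c * x = algebraMap Q C q * r x ^ n * x := by
        rw [← hq]
        conv_lhs => rw [← hpow n]
        ring
      rw [this]
      refine T.mul_mem (T.mul_mem (T.algebraMap_mem q) (T.pow_mem ?_ n)) ?_
      · apply Algebra.subset_adjoin
        have hx' : x ∈ s := hx
        simp only [Finset.coe_union, Finset.coe_image]
        exact Or.inr ⟨x, hx, rfl⟩
      · apply Algebra.subset_adjoin
        simp only [Finset.coe_union, Finset.coe_image]
        exact Or.inl hx
    | zero => intro c; simp
    | add x y _ _ hx hy => intro c; rw [mul_add]; exact T.add_mem (hx c) (hy c)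
    | smul a x _ hx => intro c; rw [smul_eq_mul, ← mul_assoc]; exact hx _
  refine ⟨⟨s ∪ s.image r, ?_⟩⟩
  change T = ⊤
  rw [eq_top_iff]
  rintro c -
  obtain ⟨q, hq⟩ := h2 c
  have hm : c - algebraMap Q C q ∈ J := by
    simp only [J, Submodule.mem_iInf]
    intro n
    obtain ⟨c', hc'⟩ := hq n
    rw [hc', Ideal.span_singleton_pow, smul_eq_mul, Ideal.mul_top]
    exact Ideal.mem_span_singleton'.2 ⟨c', mul_comm _ _⟩
  have := T.add_mem (hJ _ hm 1) (T.algebraMap_mem q)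
  simpa using this

/-- The action of power series on a torsion module. -/
theorem PureFT.exists_action {P D : Type*} [CommRing P] [AddCommGroup D] [Module P D] (f : P)
    (h : ∀ d : D, ∃ n : ℕ, f ^ n • d = 0) :
    ∃ φ : PowerSeries P →ₗ[P] D →ₗ[P] D, (∀ d, φ 1 d = d) ∧
      ∀ q d, φ (PowerSeries.X * q) d = φ q (f • d) := by
  choose n hn using h
  let F : PowerSeries P → D → ℕ → D := fun q d N =>
    ∑ i ∈ Finset.range N, (PowerSeries.coeff i q * f ^ i) • d
  have hF0 : ∀ q d N, f ^ N • d = 0 → ∀ M, N ≤ M → F q d N = F q d M := by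
    intro q d N hN M hM
    refine Finset.sum_subset (Finset.range_mono hM) ?_
    intro i _ hi
    have : N ≤ i := by simpa using hi
    obtain ⟨k, rfl⟩ := Nat.exists_eq_add_of_le this
    rw [mul_smul, pow_add, mul_comm (f ^ N), mul_smul, hN, smul_zero, smul_zero]
  have hF : ∀ q d N, f ^ N • d = 0 → F q d (n d) = F q d N := by
    intro q d N hN
    rw [hF0 q d N hN _ (le_max_left N (n d)), hF0 q d (n d) (hn d) _ (le_max_right N (n d))]
  have hz : ∀ d M, n d ≤ M → f ^ M • d = 0 := by
    intro d M hM
    obtain ⟨k, rfl⟩ := Nat.exists_eq_add_of_le hM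
    rw [pow_add, mul_comm, mul_smul, hn, smul_zero]
  refine ⟨LinearMap.mk₂ P (fun q d => F q d (n d)) ?_ ?_ ?_ ?_, ?_, ?_⟩
  · intro q q' d
    simp [F, add_mul, add_smul, Finset.sum_add_distrib]
  · intro c q d
    simp [F, Finset.smul_sum, mul_smul]
  · intro q d d'
    let N := max (n d) (max (n d') (n (d + d')))
    have e1 : n d ≤ N := by simp [N]
    have e2 : n d' ≤ N := by simp [N]
    have e3 : n (d + d') ≤ N := by simp [N]
    rw [hF q d N (hz _ _ e1), hF q d' N (hz _ _ e2), hF q (d + d') N (hz _ _ e3)]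
    simp [F, Finset.sum_add_distrib]
  · intro c q d
    have : f ^ n d • (c • d) = 0 := by rw [smul_comm, hn, smul_zero]
    rw [hF q (c • d) _ this]
    simp only [F, Finset.smul_sum]
    exact Finset.sum_congr rfl fun i _ => smul_comm _ _ _
  · intro d
    simp only [LinearMap.mk₂_apply]
    rw [hF 1 d (n d + 1) (hz _ _ (Nat.le_succ _))]
    simp only [F]
    rw [Finset.sum_range_succ']
    simp [PowerSeries.coeff_one]
  · intro q d
    simp only [LinearMap.mk₂_apply]
    have : f ^ n d • (f • d) = 0 := by rw [smul_comm, hn, smul_zero]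
    rw [hF q (f • d) _ this, hF _ d (n d + 1) (hz _ _ (Nat.le_succ _))]
    simp only [F]
    rw [Finset.sum_range_succ']
    simp [PowerSeries.coeff_succ_X_mul, ← mul_smul, pow_succ, mul_assoc]

theorem PureFT.descend {P A : Type*} [CommRing P] [CommRing A] [Algebra P A] (f : P)
    (h1 : ∀ a : A, ∃ (n : ℕ) (p : P), algebraMap P A f ^ n * a = algebraMap P A p)
    (h : Algebra.FiniteType (PowerSeries P) ((PowerSeries P ⊗[P] A) ⧸ Ideal.span
      {((PowerSeries.X : PowerSeries P) ⊗ₜ[P] (1 : A) - 1 ⊗ₜ[P] algebraMap P A f :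
        PowerSeries P ⊗[P] A)})) :
    Algebra.FiniteType P A := by
  classical
  set Q := PowerSeries P
  set 𝔞 : Ideal (Q ⊗[P] A) := Ideal.span
      {((PowerSeries.X : PowerSeries P) ⊗ₜ[P] (1 : A) - 1 ⊗ₜ[P] algebraMap P A f :
        PowerSeries P ⊗[P] A)} with h𝔞
  let ι : A → (Q ⊗[P] A) ⧸ 𝔞 := fun a => Ideal.Quotient.mk 𝔞 (1 ⊗ₜ a)
  have key : ∀ x : (Q ⊗[P] A) ⧸ 𝔞, ∃ F : Finset A, x ∈ Algebra.adjoin Q (ι '' F) := by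
    intro x
    obtain ⟨e, rfl⟩ := Ideal.Quotient.mk_surjective x
    induction e with
    | zero => exact ⟨∅, by simp⟩
    | add x y hx hy =>
      obtain ⟨F, hF⟩ := hx
      obtain ⟨G, hG⟩ := hy
      refine ⟨F ∪ G, ?_⟩
      rw [map_add]
      refine Subalgebra.add_mem _ (Algebra.adjoin_mono ?_ hF) (Algebra.adjoin_mono ?_ hG)
      · exact Set.image_mono (by simp)
      · exact Set.image_mono (by simp)
    | tmul q a =>
      refine ⟨{a}, ?_⟩
      have : Ideal.Quotient.mk 𝔞 (q ⊗ₜ a) = q • ι a := by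
        have : (q ⊗ₜ[P] a : Q ⊗[P] A) = q • (1 ⊗ₜ a) := by simp [TensorProduct.smul_tmul']
        rw [this]; rfl
      rw [this]
      exact Subalgebra.smul_mem _ (Algebra.subset_adjoin (Set.mem_image_of_mem ι (by simp))) _
  choose F hF using key
  obtain ⟨s, hs⟩ := h.out
  let F0 := s.biUnion F
  let U : Subalgebra P A := Algebra.adjoin P (F0 : Set A)
  refine ⟨⟨F0, ?_⟩⟩
  change U = ⊤
  have htor : ∀ d : A ⧸ (Subalgebra.toSubmodule U), ∃ n : ℕ, f ^ n • d = 0 := by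
    intro d
    obtain ⟨a, rfl⟩ := Submodule.mkQ_surjective _ d
    obtain ⟨n, p, hp⟩ := h1 a
    refine ⟨n, ?_⟩
    rw [← map_smul, Submodule.mkQ_apply, Submodule.Quotient.mk_eq_zero, Algebra.smul_def,
      map_pow, hp]
    exact U.algebraMap_mem p
  obtain ⟨φ, hφ1, hφX⟩ := PureFT.exists_action f htor
  let π := (Subalgebra.toSubmodule U).mkQ
  let ψ : Q ⊗[P] A →ₗ[P] (A ⧸ (Subalgebra.toSubmodule U)) :=
    TensorProduct.lift (φ.compl₂ π)
  have hψ : ∀ q a, ψ (q ⊗ₜ a) = φ q (π a) := fun q a => by simp [ψ]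
  have hψ𝔞 : ∀ e ∈ 𝔞, ψ e = 0 := by
    intro e he
    obtain ⟨e, rfl⟩ := Ideal.mem_span_singleton'.1 he
    clear he
    induction e with
    | zero => simp
    | add x y hx hy => rw [add_mul, map_add, hx, hy, add_zero]
    | tmul q a =>
      rw [mul_sub, Algebra.TensorProduct.tmul_mul_tmul, Algebra.TensorProduct.tmul_mul_tmul,
        map_sub, hψ, hψ, mul_comm q, hφX, mul_one, mul_one, mul_comm a, ← Algebra.smul_def]
      simp only [map_smul, sub_self]
  let V := ((Algebra.TensorProduct.map (AlgHom.id Q Q) U.val).range).map (Ideal.Quotient.mkₐ Q 𝔞)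
  have hV : V = ⊤ := by
    rw [eq_top_iff, ← hs]
    refine Algebra.adjoin_le ?_
    intro x hx
    have h3 : Algebra.adjoin Q (ι '' F x) ≤ V := by
      refine Algebra.adjoin_le ?_
      rintro _ ⟨a, ha, rfl⟩
      have haU : a ∈ U := Algebra.subset_adjoin (by
        simp only [F0, Finset.coe_biUnion, Set.mem_iUnion]
        exact ⟨x, hx, ha⟩)
      refine ⟨1 ⊗ₜ a, ⟨1 ⊗ₜ ⟨a, haU⟩, ?_⟩, rfl⟩
      simp
    exact h3 (hF x)
  rw [eq_top_iff]
  rintro a -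
  have : ι a ∈ V := hV ▸ Algebra.mem_top
  obtain ⟨e, ⟨e', he'⟩, he⟩ := this
  have hψe : ψ e = 0 := by
    rw [← he']
    clear he' he
    induction e' with
    | zero => simp
    | add x y hx hy => rw [map_add, map_add, hx, hy, add_zero]
    | tmul q a =>
      have : π (a : A) = 0 := by
        rw [Submodule.mkQ_apply, Submodule.Quotient.mk_eq_zero]; exact a.2
      simp only [AlgHom.toRingHom_eq_coe, RingHom.coe_coe, Algebra.TensorProduct.map_tmul,
        AlgHom.id_apply, Subalgebra.coe_val]
      rw [hψ, this, map_zero]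
  have h4 : e - 1 ⊗ₜ a ∈ 𝔞 := by
    rw [← Ideal.Quotient.eq]; exact he
  have h5 := hψ𝔞 _ h4
  rw [map_sub, hψe, zero_sub, neg_eq_zero, hψ, hφ1, Submodule.mkQ_apply,
    Submodule.Quotient.mk_eq_zero] at h5
  exact h5

theorem PureFT.core_aux {P A Q : Type*} [CommRing P] [CommRing A] [Algebra P A] (f : P)
    [CommRing Q] [Algebra P Q] (x : Q)
    (hQ1 : ∀ q : Q, ∃ (p : P) (q' : Q), q = algebraMap P Q p + x * q')
    (hQ2 : ∀ p : ℕ → P, ∃ q : Q, ∀ n, x ^ n ∣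
      q - ∑ i ∈ Finset.range n, algebraMap P Q (p i) * x ^ i)
    (h1 : ∀ a : A, ∃ (n : ℕ) (p : P), algebraMap P A f ^ n * a = algebraMap P A p)
    (h2 : ∀ a : A, ∃ (p : P) (a' : A), a = algebraMap P A p + algebraMap P A f * a')
    [IsNoetherianRing (Q ⊗[P] A)] :
    Algebra.FiniteType Q ((Q ⊗[P] A) ⧸ Ideal.span
      {(x ⊗ₜ[P] (1 : A) - 1 ⊗ₜ[P] algebraMap P A f : Q ⊗[P] A)}) := by
  set 𝔞 : Ideal (Q ⊗[P] A) := Ideal.span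
      {(x ⊗ₜ[P] (1 : A) - 1 ⊗ₜ[P] algebraMap P A f :
        Q ⊗[P] A)} with h𝔞
  let al : Q →+* (Q ⊗[P] A) ⧸ 𝔞 := algebraMap _ _
  have hXf : al x = al (algebraMap P Q f) := by
    change Ideal.Quotient.mk 𝔞 (x ⊗ₜ 1) = Ideal.Quotient.mk 𝔞 (algebraMap P Q f ⊗ₜ 1)
    rw [Ideal.Quotient.eq]
    have : (algebraMap P Q f : Q) ⊗ₜ[P] (1 : A) = 1 ⊗ₜ algebraMap P A f := by
      rw [Algebra.algebraMap_eq_smul_one (A := Q), Algebra.algebraMap_eq_smul_one (A := A),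
        TensorProduct.smul_tmul]
    rw [this]
    exact Ideal.subset_span rfl
  have hmkt : ∀ (q : Q) (a : A), Ideal.Quotient.mk 𝔞 (q ⊗ₜ a) =
      al q * Ideal.Quotient.mk 𝔞 (1 ⊗ₜ a) := by
    intro q a
    change _ = Ideal.Quotient.mk 𝔞 (q ⊗ₜ 1) * Ideal.Quotient.mk 𝔞 (1 ⊗ₜ a)
    rw [← map_mul]; simp
  have hmkp : ∀ p : P, Ideal.Quotient.mk 𝔞 (1 ⊗ₜ algebraMap P A p) =
      al (algebraMap P Q p) := by
    intro p
    change _ = Ideal.Quotient.mk 𝔞 (algebraMap P Q p ⊗ₜ 1)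
    congr 1
    rw [Algebra.algebraMap_eq_smul_one (A := Q), Algebra.algebraMap_eq_smul_one (A := A),
        TensorProduct.smul_tmul]
  let j : A →+* (Q ⊗[P] A) ⧸ 𝔞 := (Ideal.Quotient.mk 𝔞).comp
    (Algebra.TensorProduct.includeRight : A →ₐ[P] Q ⊗[P] A).toRingHom
  have hj : ∀ a, Ideal.Quotient.mk 𝔞 (1 ⊗ₜ a) = j a := fun a => rfl
  simp only [hj] at hmkt hmkp
  have hjf : j (algebraMap P A f) = al x := by rw [hmkp, hXf]
  have step : ∀ c : (Q ⊗[P] A) ⧸ 𝔞, ∃ (p : P) (c' : (Q ⊗[P] A) ⧸ 𝔞),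
      c = al (algebraMap P Q p) + al x * c' := by
    intro c
    obtain ⟨e, rfl⟩ := Ideal.Quotient.mk_surjective c
    induction e with
    | zero => exact ⟨0, 0, by simp⟩
    | add u v hx hy =>
      obtain ⟨p, c, h⟩ := hx
      obtain ⟨p', c', h'⟩ := hy
      refine ⟨p + p', c + c', ?_⟩
      rw [map_add, h, h', map_add, map_add]; ring
    | tmul q a =>
      obtain ⟨p, a', ha⟩ := h2 a
      obtain ⟨p₀, q', hq'⟩ := hQ1 q
      refine ⟨p₀ * p, al q' * al (algebraMap P Q p)
        + al q * j a', ?_⟩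
      rw [hmkt, ha, map_add, map_mul, hjf, hmkp, map_mul, map_mul]
      have := congrArg al hq'
      rw [map_add, map_mul] at this
      linear_combination (al (algebraMap P Q p)) * this
  refine PureFT.finiteType_of_noeth x ?_ ?_
  · change ∀ c, ∃ (n : ℕ) (q : Q), al x ^ n * c = al q
    intro c
    obtain ⟨e, rfl⟩ := Ideal.Quotient.mk_surjective c
    induction e with
    | zero => exact ⟨0, 0, by simp⟩
    | add u v hx hy =>
      obtain ⟨n, q, h⟩ := hx
      obtain ⟨n', q', h'⟩ := hy
      refine ⟨n + n', x ^ n' * q + x ^ n * q', ?_⟩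
      rw [map_add, map_add, map_mul, map_mul, ← h, ← h', map_pow, map_pow]
      ring
    | tmul q a =>
      obtain ⟨n, p, h⟩ := h1 a
      refine ⟨n, q * algebraMap P Q p, ?_⟩
      have := congrArg j h
      rw [map_mul, map_pow, hjf, hmkp] at this
      rw [hmkt, map_mul, ← this]
      ring
  · change ∀ c, ∃ q : Q, ∀ n : ℕ, ∃ c', c - al q = al x ^ n * c'
    intro c
    choose p nx hstep using step
    let s : ℕ → (Q ⊗[P] A) ⧸ 𝔞 := fun n => nx^[n] c
    obtain ⟨q, hq⟩ := hQ2 fun n => p (s n)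
    refine ⟨q, fun n => ?_⟩
    have hc : ∀ n, c = al (∑ i ∈ Finset.range n, algebraMap P Q (p (s i)) * x ^ i)
        + al x ^ n * s n := by
      intro n
      induction n with
      | zero => simp [s]
      | succ n ih =>
        rw [Finset.sum_range_succ, map_add, map_mul, map_pow]
        have h3 := hstep (s n)
        have h4 : s (n + 1) = nx (s n) := Function.iterate_succ_apply' _ _ _
        rw [h4]
        linear_combination ih + al x ^ n * h3
    obtain ⟨d, hd⟩ := hq n
    refine ⟨s n - al d, ?_⟩
    have h5 := congrArg (al) hd
    rw [map_sub, map_mul, map_pow] at h5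
    linear_combination hc n - h5

theorem PureFT.core {P A : Type*} [CommRing P] [CommRing A] [Algebra P A] (f : P)
    (h1 : ∀ a : A, ∃ (n : ℕ) (p : P), algebraMap P A f ^ n * a = algebraMap P A p)
    (h2 : ∀ a : A, ∃ (p : P) (a' : A), a = algebraMap P A p + algebraMap P A f * a')
    [IsNoetherianRing (PowerSeries P ⊗[P] A)] :
    Algebra.FiniteType P A := by
  refine PureFT.descend f h1 ?_
  refine PureFT.core_aux f (PowerSeries.X : PowerSeries P) ?_ ?_ h1 h2
  · intro q
    have : (PowerSeries.X : PowerSeries P) ∣ q - PowerSeries.C (PowerSeries.coeff 0 q) := by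
      rw [PowerSeries.X_dvd_iff]; simp
    obtain ⟨q', h⟩ := this
    refine ⟨PowerSeries.coeff 0 q, q', ?_⟩
    rw [← h]
    change q = PowerSeries.C (PowerSeries.coeff 0 q) + _
    ring
  · intro p
    refine ⟨PowerSeries.mk p, fun n => ?_⟩
    change _ ∣ _ - ∑ i ∈ Finset.range n, PowerSeries.C (p i) * PowerSeries.X ^ i
    rw [PowerSeries.X_pow_dvd_iff]
    intro m hm
    simp [PowerSeries.coeff_X_pow, hm]

theorem PureFT.noeth {A B : Type u} [CommRing A] [CommRing B] [Algebra A B]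
    (hpure : ∀ (M : Type u) [AddCommGroup M] [Module A M],
      Function.Injective (fun m : M => (m ⊗ₜ[A] (1 : B) : M ⊗[A] B)))
    (C : Type u) [CommRing C] [Algebra A C] [IsNoetherianRing (C ⊗[A] B)] :
    IsNoetherianRing C := by
  let ι : C →+* C ⊗[A] B := Algebra.TensorProduct.includeLeftRingHom
  have hle : ∀ I : Ideal C, (I.map ι).comap ι ≤ I := by
    intro I x hx
    let ρ : C ⊗[A] B →ₐ[A] (C ⧸ I) ⊗[A] B :=
      Algebra.TensorProduct.map (Ideal.Quotient.mkₐ A I) (AlgHom.id A B)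
    have h1 : I.map ι ≤ RingHom.ker ρ.toRingHom := by
      rw [Ideal.map_le_iff_le_comap]
      intro y hy
      change ρ (y ⊗ₜ 1) = 0
      have : Ideal.Quotient.mk I y = 0 := Ideal.Quotient.eq_zero_iff_mem.2 hy
      simp [ρ, this]
    have h2 : ρ (x ⊗ₜ 1) = 0 := h1 hx
    have h3 : (Ideal.Quotient.mk I x) ⊗ₜ[A] (1 : B) = 0 := by simpa [ρ] using h2
    have h4 := @hpure (C ⧸ I) _ _ (Ideal.Quotient.mk I x) 0 (by simpa using h3)
    exact Ideal.Quotient.eq_zero_iff_mem.1 h4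
  have hmono : StrictMono (fun I : Ideal C => I.map ι) := by
    intro I J hIJ
    refine lt_of_le_of_ne (Ideal.map_mono hIJ.le) ?_
    intro h
    refine absurd hIJ (not_lt_of_ge ?_)
    have h' : I.map ι = J.map ι := h
    have h2 : J ≤ (J.map ι).comap ι := Ideal.le_comap_map
    rw [← h'] at h2
    exact h2.trans (hle I)
  rw [IsNoetherianRing, isNoetherian_iff']
  have : WellFoundedGT (Ideal (C ⊗[A] B)) := inferInstance
  exact hmono.wellFoundedGT

theorem PureFT.noeth_self {A B : Type u} [CommRing A] [CommRing B] [Algebra A B]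
    (hpure : ∀ (M : Type u) [AddCommGroup M] [Module A M],
      Function.Injective (fun m : M => (m ⊗ₜ[A] (1 : B) : M ⊗[A] B)))
    [IsNoetherianRing B] : IsNoetherianRing A := by
  have : IsNoetherianRing (A ⊗[A] B) :=
    isNoetherianRing_of_ringEquiv B (Algebra.TensorProduct.lid A B).symm.toRingEquiv
  exact PureFT.noeth hpure A

theorem PureFT.noeth_tensor {P A B : Type u} [CommRing P] [CommRing A] [CommRing B] [Algebra P A]
    [Algebra A B] [Algebra P B] [IsScalarTower P A B]
    (hpure : ∀ (M : Type u) [AddCommGroup M] [Module A M],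
      Function.Injective (fun m : M => (m ⊗ₜ[A] (1 : B) : M ⊗[A] B)))
    [Algebra.FiniteType P B] (Q : Type u) [CommRing Q] [Algebra P Q] [IsNoetherianRing Q] :
    IsNoetherianRing (Q ⊗[P] A) := by
  have h1 : IsNoetherianRing (Q ⊗[P] B) := Algebra.FiniteType.isNoetherianRing Q _
  let g1 : Q →ₐ[P] (A ⊗[P] Q) ⊗[A] B :=
    ((Algebra.TensorProduct.includeLeft : (A ⊗[P] Q) →ₐ[A] (A ⊗[P] Q) ⊗[A] B).restrictScalars P).comp
      Algebra.TensorProduct.includeRight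
  let g2 : B →ₐ[P] (A ⊗[P] Q) ⊗[A] B :=
    (Algebra.TensorProduct.includeRight : B →ₐ[A] (A ⊗[P] Q) ⊗[A] B).restrictScalars P
  let g := Algebra.TensorProduct.productMap g1 g2
  have hg : Function.Surjective g := by
    intro x
    change x ∈ g.range
    induction x with
    | zero => exact Subalgebra.zero_mem _
    | add x y hx hy => exact Subalgebra.add_mem _ hx hy
    | tmul e b =>
      induction e with
      | zero => rw [TensorProduct.zero_tmul]; exact Subalgebra.zero_mem _
      | add x y hx hy => rw [TensorProduct.add_tmul]; exact Subalgebra.add_mem _ hx hy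
      | tmul a q =>
        refine ⟨q ⊗ₜ (a • b), ?_⟩
        have : (a ⊗ₜ[P] q : A ⊗[P] Q) = a • (1 ⊗ₜ q) := by simp [TensorProduct.smul_tmul']
        rw [this, TensorProduct.smul_tmul]
        change g (q ⊗ₜ (a • b)) = _
        rw [Algebra.TensorProduct.productMap_apply_tmul]
        change ((1 ⊗ₜ[P] q : A ⊗[P] Q) ⊗ₜ[A] (1 : B)) * ((1 : A ⊗[P] Q) ⊗ₜ[A] (a • b)) = _
        rw [Algebra.TensorProduct.tmul_mul_tmul, one_mul, mul_one]
  have h2 : IsNoetherianRing ((A ⊗[P] Q) ⊗[A] B) :=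
    isNoetherianRing_of_surjective _ _ g.toRingHom hg
  have h3 : IsNoetherianRing (A ⊗[P] Q) := PureFT.noeth hpure _
  exact isNoetherianRing_of_ringEquiv _ (Algebra.TensorProduct.comm P A Q).toRingEquiv

theorem PureFT.artin_tate {R L : Type u} [CommRing R] [IsNoetherianRing R] [CommRing L]
    [Algebra R L] (Ay E : Subalgebra R L) (hle : Ay ≤ E) (hE : E.FG)
    (hint : ∀ x ∈ E, IsIntegral Ay x) : Ay.FG := by
  let : Algebra Ay E := (Subalgebra.inclusion hle).toAlgebra
  have : IsScalarTower R Ay E := IsScalarTower.of_algebraMap_eq fun _ => rfl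
  have : IsScalarTower Ay E L := IsScalarTower.of_algebraMap_eq fun _ => rfl
  have hEft : Algebra.FiniteType R E := (Subalgebra.fg_iff_finiteType _).1 hE
  have hEft' : Algebra.FiniteType Ay E := Algebra.FiniteType.of_restrictScalars_finiteType R Ay E
  have : Algebra.IsIntegral Ay E := ⟨fun x => by
    have := hint x x.2
    exact (isIntegral_algHom_iff (IsScalarTower.toAlgHom Ay E L) Subtype.val_injective).1 this⟩
  have hfin : Module.Finite Ay E := Algebra.IsIntegral.finite
  have hAyFT := fg_of_fg_of_fg R Ay E hEft.out hfin.fg_top (Subalgebra.inclusion_injective hle)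
  exact Ay.fg_top.1 hAyFT

theorem PureFT.generic_aux {R A B L : Type u} [CommRing R] [CommRing A] [CommRing B]
    [IsNoetherianRing R] [Algebra R A] [Algebra A B] [Algebra R B] [IsScalarTower R A B]
    [Algebra.FiniteType R B] [IsDomain A] [Field L] [Algebra A L] [Algebra R L]
    [IsScalarTower R A L] [Algebra.IsAlgebraic A L]
    (hinj : Function.Injective (algebraMap A L)) (g : B →ₐ[A] L) :
    ∃ f : A, f ≠ 0 ∧ ∃ A0 : Subalgebra R A, A0.FG ∧ ∀ a : A, ∃ n : ℕ, f ^ n * a ∈ A0 := by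
  classical
  let gR : B →ₐ[R] L := g.restrictScalars R
  obtain ⟨t, ht⟩ := (inferInstance : Algebra.FiniteType R B).out
  obtain ⟨y, hy0, hy⟩ := Algebra.IsAlgebraic.exists_integral_multiples A (t.image g)
  have hyL : algebraMap A L y ≠ 0 := by
    rw [Ne, map_eq_zero_iff _ hinj]; exact hy0
  let yi : L := (algebraMap A L y)⁻¹
  let E : Subalgebra R L := Algebra.adjoin R ((insert yi (t.image g) : Finset L) : Set L)
  have hgE : ∀ b, g b ∈ E := by
    intro b
    have : b ∈ Algebra.adjoin R (t : Set B) := ht ▸ Algebra.mem_top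
    have h2 : gR b ∈ (Algebra.adjoin R (t : Set B)).map gR := ⟨b, this, rfl⟩
    rw [AlgHom.map_adjoin] at h2
    refine Algebra.adjoin_mono ?_ h2
    intro x hx
    simp only [Finset.coe_insert, Finset.coe_image]
    exact Or.inr hx
  let Ay : Subalgebra R L := (Algebra.adjoin A {yi}).restrictScalars R
  have hAyA : ∀ a, algebraMap A L a ∈ Ay := fun a => (Algebra.adjoin A {yi}).algebraMap_mem a
  have hyiAy : yi ∈ Ay := Algebra.subset_adjoin (R := A) rfl
  have hle : Ay ≤ E := by
    intro x hx
    change x ∈ Algebra.adjoin A {yi} at hx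
    induction hx using Algebra.adjoin_induction with
    | mem x hx =>
      refine Algebra.subset_adjoin ?_
      rw [Set.mem_singleton_iff.1 hx]; simp
    | algebraMap a =>
      rw [← g.commutes]; exact hgE _
    | add x y _ _ hx hy => exact E.add_mem hx hy
    | mul x y _ _ hx hy => exact E.mul_mem hx hy
  have hden : ∀ x ∈ Ay, ∃ (n : ℕ) (a : A), algebraMap A L y ^ n * x = algebraMap A L a := by
    intro x hx
    change x ∈ Algebra.adjoin A {yi} at hx
    induction hx using Algebra.adjoin_induction with
    | mem x hx =>
      refine ⟨1, 1, ?_⟩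
      rw [Set.mem_singleton_iff.1 hx]; simp [yi, hyL]
    | algebraMap a => exact ⟨0, a, by simp⟩
    | add x x' _ _ hx hx' =>
      obtain ⟨n, a, h⟩ := hx
      obtain ⟨n', a', h'⟩ := hx'
      refine ⟨n + n', y ^ n' * a + y ^ n * a', ?_⟩
      simp only [map_add, map_mul, map_pow, ← h, ← h']; ring
    | mul x x' _ _ hx hx' =>
      obtain ⟨n, a, h⟩ := hx
      obtain ⟨n', a', h'⟩ := hx'
      refine ⟨n + n', a * a', ?_⟩
      simp only [map_mul, ← h, ← h']; ring
  let : Algebra A Ay := ((algebraMap A L).codRestrict Ay hAyA).toAlgebra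
  have : IsScalarTower A Ay L := IsScalarTower.of_algebraMap_eq fun _ => rfl
  have hint : ∀ x ∈ E, IsIntegral Ay x := by
    intro x hx
    induction hx using Algebra.adjoin_induction with
    | mem x hx =>
      simp only [Finset.coe_insert] at hx
      rcases hx with rfl | hx
      · exact isIntegral_algebraMap (x := (⟨yi, hyiAy⟩ : Ay))
      · have h1 : IsIntegral Ay (y • x) := (hy x hx).tower_top
        have h2 : x = yi * (y • x) := by
          rw [Algebra.smul_def]; simp [yi, hyL]
        rw [h2]
        exact (isIntegral_algebraMap (x := (⟨yi, hyiAy⟩ : Ay))).mul h1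
    | algebraMap a =>
      exact isIntegral_algebraMap (x := algebraMap R Ay a)
    | add x y _ _ hx hy => exact hx.add hy
    | mul x y _ _ hx hy => exact hx.mul hy
  have hAyFT := Ay.fg_top.2 (PureFT.artin_tate Ay E hle ⟨_, rfl⟩ hint)
  obtain ⟨s, hs⟩ := hAyFT
  choose n a ha using fun x : Ay => hden x x.2
  let A0 : Subalgebra R A := Algebra.adjoin R ((insert y (s.image a) : Finset A) : Set A)
  have hyA0 : y ∈ A0 := Algebra.subset_adjoin (by simp)
  have hA0 : ∀ x : Ay, ∃ (n : ℕ), ∃ a ∈ A0, algebraMap A L y ^ n * (x : L) = algebraMap A L a := by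
    intro x
    have hx : x ∈ Algebra.adjoin R (s : Set Ay) := hs ▸ Algebra.mem_top
    induction hx using Algebra.adjoin_induction with
    | mem x hx =>
      refine ⟨n x, a x, Algebra.subset_adjoin ?_, ha x⟩
      simp only [Finset.coe_insert, Finset.coe_image]
      exact Or.inr ⟨x, hx, rfl⟩
    | algebraMap r =>
      refine ⟨0, algebraMap R A r, A0.algebraMap_mem r, ?_⟩
      rw [← IsScalarTower.algebraMap_apply R A L]; simp
    | add x x' _ _ hx hx' =>
      obtain ⟨n, a, ha, h⟩ := hx
      obtain ⟨n', a', ha', h'⟩ := hx'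
      refine ⟨n + n', y ^ n' * a + y ^ n * a', A0.add_mem (A0.mul_mem (A0.pow_mem hyA0 _) ha)
        (A0.mul_mem (A0.pow_mem hyA0 _) ha'), ?_⟩
      simp only [map_add, map_mul, map_pow, ← h, ← h', Subalgebra.coe_add]; ring
    | mul x x' _ _ hx hx' =>
      obtain ⟨n, a, ha, h⟩ := hx
      obtain ⟨n', a', ha', h'⟩ := hx'
      refine ⟨n + n', a * a', A0.mul_mem ha ha', ?_⟩
      simp only [map_mul, ← h, ← h', Subalgebra.coe_mul]; ring
  refine ⟨y, hy0, A0, ⟨_, rfl⟩, fun b => ?_⟩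
  obtain ⟨n, c, hc, h⟩ := hA0 ⟨algebraMap A L b, hAyA b⟩
  refine ⟨n, ?_⟩
  have : y ^ n * b = c := hinj (by simpa using h)
  rw [this]; exact hc

theorem PureFT.generic {R A B : Type u} [CommRing R] [CommRing A] [CommRing B]
    [IsNoetherianRing R] [Algebra R A] [Algebra A B] [Algebra R B] [IsScalarTower R A B]
    [Algebra.FiniteType R B] [IsDomain A]
    (hpure : ∀ (M : Type u) [AddCommGroup M] [Module A M],
      Function.Injective (fun m : M => (m ⊗ₜ[A] (1 : B) : M ⊗[A] B))) :
    ∃ f : A, f ≠ 0 ∧ ∃ A0 : Subalgebra R A, A0.FG ∧ ∀ a : A, ∃ n : ℕ, f ^ n * a ∈ A0 := by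
  classical
  let K := FractionRing A
  have hAB : Algebra.FiniteType A B := Algebra.FiniteType.of_restrictScalars_finiteType R A B
  have : Nontrivial (K ⊗[A] B) := (@hpure K _ _).nontrivial
  obtain ⟨m, hm⟩ := Ideal.exists_maximal (K ⊗[A] B)
  let L := (K ⊗[A] B) ⧸ m
  let : Field L := Ideal.Quotient.field m
  have : Module.Finite K L := finite_of_finite_type_of_isJacobsonRing K L
  have : Algebra.IsAlgebraic K L := Algebra.IsAlgebraic.of_finite K L
  have hAL : Algebra.IsAlgebraic A L := (IsFractionRing.comap_isAlgebraic_iff (A := A) (K := K)).2 this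
  have hinj : Function.Injective (algebraMap A L) := by
    rw [IsScalarTower.algebraMap_eq A K L]
    exact (algebraMap K L).injective.comp (IsFractionRing.injective A K)
  let g : B →ₐ[A] L := ((Ideal.Quotient.mkₐ K m).restrictScalars A).comp
    Algebra.TensorProduct.includeRight
  exact PureFT.generic_aux hinj g

/-- A finite type quotient is surjected on by a finitely generated subalgebra. -/
theorem PureFT.exists_lift {R A : Type u} [CommRing R] [CommRing A] [Algebra R A] (x : A)
    (h : Algebra.FiniteType R (A ⧸ Ideal.span {x})) :
    ∃ A1 : Subalgebra R A, A1.FG ∧ ∀ a : A, ∃ p ∈ A1, ∃ a' : A, a = p + x * a' := by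
  classical
  obtain ⟨s, hs⟩ := h.out
  choose l hl using Ideal.Quotient.mk_surjective (I := Ideal.span {x})
  refine ⟨Algebra.adjoin R ((s.image l : Finset A) : Set A), ⟨_, rfl⟩, fun a => ?_⟩
  have hm : (Algebra.adjoin R ((s.image l : Finset A) : Set A)).map
      (Ideal.Quotient.mkₐ R (Ideal.span {x})) = ⊤ := by
    rw [AlgHom.map_adjoin, ← hs]
    congr 1
    ext y
    simp [hl]
  have : Ideal.Quotient.mkₐ R (Ideal.span {x}) a ∈
      (Algebra.adjoin R ((s.image l : Finset A) : Set A)).map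
      (Ideal.Quotient.mkₐ R (Ideal.span {x})) := hm ▸ Algebra.mem_top
  obtain ⟨p, hp, hpa⟩ := this
  have h2 : a - p ∈ Ideal.span {x} := by
    rw [← Ideal.Quotient.eq]; exact hpa.symm
  obtain ⟨a', ha'⟩ := Ideal.mem_span_singleton'.1 h2
  exact ⟨p, hp, a', by rw [mul_comm, ha']; ring⟩

theorem PureFT.step {R A B : Type u} [CommRing R] [CommRing A] [CommRing B]
    [IsNoetherianRing R] [Algebra R A] [Algebra A B] [Algebra R B] [IsScalarTower R A B]
    [Algebra.FiniteType R B]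
    (hpure : ∀ (M : Type u) [AddCommGroup M] [Module A M],
      Function.Injective (fun m : M => (m ⊗ₜ[A] (1 : B) : M ⊗[A] B)))
    (ih : ∀ I : Ideal A, I ≠ ⊥ → Algebra.FiniteType R (A ⧸ I)) :
    Algebra.FiniteType R A := by
  classical
  have ih' : ∀ x : A, x ≠ 0 → ∃ A1 : Subalgebra R A, A1.FG ∧
      ∀ a : A, ∃ p ∈ A1, ∃ a' : A, a = p + x * a' := fun x hx =>
    PureFT.exists_lift x (ih _ (by rwa [Ne, Ideal.span_singleton_eq_bot]))
  have hfgx : ∀ x : A, (Algebra.adjoin R {x}).FG := fun x => ⟨{x}, by simp⟩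
  rcases subsingleton_or_nontrivial A with hs | hn
  · exact ⟨⟨∅, Subsingleton.elim _ _⟩⟩
  by_cases hd : NoZeroDivisors A
  · have : IsDomain A := NoZeroDivisors.to_isDomain A
    obtain ⟨f, hf0, A0, hA0, hfA0⟩ := PureFT.generic (R := R) hpure
    obtain ⟨A1, hA1, hfA1⟩ := ih' f hf0
    let P : Subalgebra R A := A0 ⊔ A1 ⊔ Algebra.adjoin R {f}
    have hPfg : P.FG := (hA0.sup hA1).sup (hfgx f)
    have h0P : A0 ≤ P := le_sup_left.trans le_sup_left
    have h1P : A1 ≤ P := le_sup_right.trans le_sup_left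
    have hfP : f ∈ P := (le_sup_right : _ ≤ P) (Algebra.subset_adjoin rfl)
    have hPft : Algebra.FiniteType R P := (Subalgebra.fg_iff_finiteType _).1 hPfg
    have hPN : IsNoetherianRing P := Algebra.FiniteType.isNoetherianRing R P
    have : IsScalarTower R P B := IsScalarTower.of_algebraMap_eq fun r =>
      IsScalarTower.algebraMap_apply R A B r
    have : IsScalarTower P A B := IsScalarTower.of_algebraMap_eq fun r => rfl
    have hPB : Algebra.FiniteType P B := Algebra.FiniteType.of_restrictScalars_finiteType R P B
    have : IsNoetherianRing (PowerSeries P ⊗[P] A) := PureFT.noeth_tensor hpure (PowerSeries P)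
    have hPA : Algebra.FiniteType P A := by
      refine PureFT.core (⟨f, hfP⟩ : P) ?_ ?_
      · intro a
        obtain ⟨n, hn⟩ := hfA0 a
        exact ⟨n, ⟨_, h0P hn⟩, rfl⟩
      · intro a
        obtain ⟨p, hp, a', h⟩ := hfA1 a
        exact ⟨⟨p, h1P hp⟩, a', h⟩
    exact Algebra.FiniteType.trans hPft hPA
  · have : ∃ x y : A, x * y = 0 ∧ x ≠ 0 ∧ y ≠ 0 := by
      by_contra! hcon
      exact hd ⟨fun {x y} h => or_iff_not_imp_left.2 (hcon x y h)⟩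
    obtain ⟨x, y, hxy, hx, hy⟩ := this
    obtain ⟨A0, hA0, hxA0⟩ := ih' x hx
    obtain ⟨A1, hA1, hyA1⟩ := ih' y hy
    let P : Subalgebra R A := A0 ⊔ A1 ⊔ Algebra.adjoin R {x}
    have hPfg : P.FG := (hA0.sup hA1).sup (hfgx x)
    have h0P : A0 ≤ P := le_sup_left.trans le_sup_left
    have h1P : A1 ≤ P := le_sup_right.trans le_sup_left
    have hxP : x ∈ P := (le_sup_right : _ ≤ P) (Algebra.subset_adjoin rfl)
    have hP : P = ⊤ := by
      rw [eq_top_iff]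
      rintro a -
      obtain ⟨p, hp, a', rfl⟩ := hxA0 a
      obtain ⟨q, hq, a'', rfl⟩ := hyA1 a'
      have : p + x * (q + y * a'') = p + x * q := by linear_combination a'' * hxy
      rw [this]
      exact P.add_mem (h0P hp) (P.mul_mem hxP (h1P hq))
    exact ⟨hP ▸ hPfg⟩

theorem PureFT.main {R A B : Type u} [CommRing R] [CommRing A] [CommRing B]
    [IsNoetherianRing R] [Algebra R A] [Algebra A B] [Algebra R B] [IsScalarTower R A B]
    [Algebra.FiniteType R B]
    (hpure : ∀ (M : Type u) [AddCommGroup M] [Module A M],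
      Function.Injective (fun m : M => (m ⊗ₜ[A] (1 : B) : M ⊗[A] B))) :
    Algebra.FiniteType R A := by
  have : IsNoetherianRing B := Algebra.FiniteType.isNoetherianRing R B
  have hA : IsNoetherianRing A := PureFT.noeth_self hpure
  have key : ∀ I : Ideal A, Algebra.FiniteType R (A ⧸ I) := by
    intro I
    induction I using IsNoetherian.induction with
    | hgt I ih =>
    let g : B →ₐ[R] (A ⧸ I) ⊗[A] B :=
      (Algebra.TensorProduct.includeRight : B →ₐ[A] (A ⧸ I) ⊗[A] B).restrictScalars R
    have hg : Function.Surjective g := by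
      intro x
      change x ∈ g.range
      induction x with
      | zero => exact Subalgebra.zero_mem _
      | add x y hx hy => exact Subalgebra.add_mem _ hx hy
      | tmul e b =>
        obtain ⟨a, rfl⟩ := Ideal.Quotient.mk_surjective e
        refine ⟨a • b, ?_⟩
        change (1 : A ⧸ I) ⊗ₜ[A] (a • b) = _
        rw [← TensorProduct.smul_tmul]
        congr 1
        rw [← Algebra.algebraMap_eq_smul_one]
        rfl
    have hft : Algebra.FiniteType R ((A ⧸ I) ⊗[A] B) :=
      Algebra.FiniteType.of_surjective g hg
    refine PureFT.step (B := (A ⧸ I) ⊗[A] B) ?_ ?_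
    · intro M _ _
      let : Module A M := Module.compHom M (Ideal.Quotient.mk I)
      have : IsScalarTower A (A ⧸ I) M := IsScalarTower.of_algebraMap_smul fun _ _ => rfl
      let e := TensorProduct.AlgebraTensorModule.cancelBaseChange A (A ⧸ I) (A ⧸ I) M B
      intro m m' h
      refine hpure M ?_
      have h' := congrArg e h
      have he : ∀ m : M, e (m ⊗ₜ (1 : (A ⧸ I) ⊗[A] B)) = m ⊗ₜ 1 := by
        intro m
        rw [Algebra.TensorProduct.one_def]
        simp [e]
      simpa only [he] using h'
    · intro J hJ
      let I' := J.comap (Ideal.Quotient.mk I)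
      have hle : I ≤ I' := by
        intro x hx
        change Ideal.Quotient.mk I x ∈ J
        rw [Ideal.Quotient.eq_zero_iff_mem.2 hx]; exact J.zero_mem
      have hlt : I < I' := by
        refine lt_of_le_of_ne hle ?_
        intro h
        apply hJ
        rw [eq_bot_iff]
        intro x hx
        obtain ⟨a, rfl⟩ := Ideal.Quotient.mk_surjective x
        have : a ∈ I := h ▸ hx
        exact Ideal.Quotient.eq_zero_iff_mem.2 this
      have hI' := ih I' hlt
      let φ : (A ⧸ I') →ₐ[R] ((A ⧸ I) ⧸ J) :=
        Ideal.quotientMapₐ J (Ideal.Quotient.mkₐ R I) le_rfl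
      refine Algebra.FiniteType.of_surjective φ ?_
      intro x
      obtain ⟨x, rfl⟩ := Ideal.Quotient.mk_surjective x
      obtain ⟨a, rfl⟩ := Ideal.Quotient.mk_surjective x
      exact ⟨Ideal.Quotient.mk I' a, rfl⟩
  have := key ⊥
  exact Algebra.FiniteType.of_surjective
    ((AlgEquiv.quotientBot R A) : (A ⧸ (⊥ : Ideal A)) →ₐ[R] A) (AlgEquiv.quotientBot R A).surjective



/-- **Theorem 1 (main theorem).** Let `R` be a Noetherian commutative ring, `B` a finitely
generated commutative `R`-algebra, and `A` an `R`-subalgebra of `B` such that the inclusion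
`A → B` is pure (i.e. for every `A`-module `M`, the map `M → M ⊗[A] B`, `m ↦ m ⊗ 1`, is
injective). Then `A` is a finitely generated `R`-algebra. -/
theorem pure_subalgebra_finiteType {R B : Type u} [CommRing R] [CommRing B]
    [IsNoetherianRing R] [Algebra R B] (hB : Algebra.FiniteType R B)
    (A : Subalgebra R B)
    (hpure : ∀ (M : Type u) [AddCommGroup M] [Module A M],
      Function.Injective (fun m : M => (m ⊗ₜ[A] (1 : B) : M ⊗[A] B))) :
    Algebra.FiniteType R A := by
  exact PureFT.main (A := A) (B := B) hpure
end

section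
/- Let R be a Noetherian commutative ring, B a finitely generated commutative R-algebra, and A an R-subalgebra of B such that B is faithfully flat as an A-module. Then A is a finitely generated R-algebra. -/
section
open MvPolynomial TensorProduct

theorem ffst_const {D E F σ ι : Type*} [CommRing D] [CommRing E] [CommRing F]
    [Algebra D E] [Algebra D F] [Module.FaithfullyFlat D F]
    (π : MvPolynomial σ D →ₐ[D] F) (g : ι → MvPolynomial σ D) (hg : ∀ j, π (g j) = 0)
    (e : E) (he : C e ∈ Ideal.span (Set.range fun j => map (algebraMap D E) (g j))) : e = 0 := by
  let Φ : MvPolynomial σ E →ₐ[D] E ⊗[D] F :=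
    (Algebra.TensorProduct.map (AlgHom.id D E) π).comp
      ((algebraTensorAlgEquiv (σ := σ) D E).symm.toAlgHom.restrictScalars D)
  have h1 : Ideal.span (Set.range fun j => map (algebraMap D E) (g j)) ≤ RingHom.ker Φ := by
    rw [Ideal.span_le]
    rintro _ ⟨j, rfl⟩
    simp [Φ, RingHom.mem_ker, algebraTensorAlgEquiv_symm_map, hg]
  have h2 : e ⊗ₜ[D] (1 : F) = 0 := by
    have := h1 he
    rw [RingHom.mem_ker] at this
    have h3 : (algebraTensorAlgEquiv (σ := σ) D E).symm (C e) = e ⊗ₜ 1 := by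
      have := algebraTensorAlgEquiv_symm_monomial D E (σ := σ) 0 e
      simpa using this
    simpa [Φ, h3] using this
  have h4 : (1 : F) ⊗ₜ[D] e = 0 := by
    have := congrArg (TensorProduct.comm D E F) h2
    simpa using this
  exact (Module.FaithfullyFlat.one_tmul_eq_zero_iff D E (A := F) e).1 h4

theorem ffst_syz {D E F σ : Type*} {ι : Type*} [Fintype ι] [CommRing D] [CommRing E] [CommRing F]
    [Algebra D E] [Algebra D F] [Module.Flat D F]
    (π : MvPolynomial σ D →ₐ[D] F) (hπ : Function.Surjective π)
    (g : ι → MvPolynomial σ D) (hg : RingHom.ker π = Ideal.span (Set.range g))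
    (h : ι → MvPolynomial σ E) (hh : ∑ j, h j * map (algebraMap D E) (g j) = 0) :
    h ∈ Submodule.span (MvPolynomial σ E)
      {t | ∃ s : ι → MvPolynomial σ D, ∑ j, s j * g j = 0 ∧
        t = fun j => map (algebraMap D E) (s j)} := by
  classical
  let J : Submodule D (MvPolynomial σ D) := LinearMap.ker π.toLinearMap
  let w : (ι → MvPolynomial σ D) →ₗ[D] MvPolynomial σ D :=
    (Fintype.linearCombination (MvPolynomial σ D) g).restrictScalars D
  have hw : ∀ s, w s = ∑ j, s j * g j := fun s => by
    simp [w, Fintype.linearCombination_apply]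
  have hwJ : ∀ s, w s ∈ J := fun s => by
    rw [LinearMap.mem_ker]
    have h0 : w s ∈ RingHom.ker π := by
      rw [hg, hw]
      exact Ideal.sum_mem _ fun j _ => Ideal.mul_mem_left _ _ (Ideal.subset_span ⟨j, rfl⟩)
    exact h0
  let v : (ι → MvPolynomial σ D) →ₗ[D] J := w.codRestrict J hwJ
  have hv : Function.Surjective v := by
    rintro ⟨p, hp⟩
    have hp' : p ∈ Ideal.span (Set.range g) := by rw [← hg]; exact hp
    obtain ⟨c, hc⟩ := (Submodule.mem_span_range_iff_exists_fun _).1 hp'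
    refine ⟨c, Subtype.ext ?_⟩
    change w c = p
    rw [hw, ← hc]; simp
  have hinj : Function.Injective (J.subtype.lTensor E) :=
    LinearMap.lTensor_injective_of_exact_of_flat π.toLinearMap hπ J.subtype
      J.subtype_injective (LinearMap.exact_subtype_ker_map _) E
  have hex : Function.Exact ((LinearMap.ker v).subtype.lTensor E) (v.lTensor E) :=
    lTensor_exact E (LinearMap.exact_subtype_ker_map v) hv
  let al : E ⊗[D] MvPolynomial σ D ≃ₐ[E] MvPolynomial σ E := algebraTensorAlgEquiv D E
  let θ : E ⊗[D] (ι → MvPolynomial σ D) →ₗ[D] (ι → MvPolynomial σ E) :=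
    LinearMap.pi fun j => (al.toLinearMap.restrictScalars D) ∘ₗ
      (LinearMap.proj j : (ι → MvPolynomial σ D) →ₗ[D] _).lTensor E
  have hθ : ∀ e s j, θ (e ⊗ₜ s) j = e • map (algebraMap D E) (s j) := by
    intro e s j
    simp [θ, al]
  have hθs : Function.Surjective θ := by
    intro h
    refine ⟨∑ j, (LinearMap.single D (fun _ => MvPolynomial σ D) j).lTensor E (al.symm (h j)), ?_⟩
    ext1 i
    have key : ∀ j (z : E ⊗[D] MvPolynomial σ D),
        θ ((LinearMap.single D (fun _ => MvPolynomial σ D) j).lTensor E z) i =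
          if i = j then al z else 0 := by
      intro j z
      induction z with
      | zero => simp
      | add x y hx hy => rw [map_add, map_add, Pi.add_apply, hx, hy]; split_ifs <;> simp
      | tmul e p =>
        rw [LinearMap.lTensor_tmul, hθ]
        by_cases hij : i = j
        · subst hij; simp [al]
        · simp [hij]
    rw [map_sum, Finset.sum_apply]
    simp [key]
  obtain ⟨z, rfl⟩ := hθs h
  have hcomm : ∀ z, al ((w.lTensor E) z) = ∑ j, θ z j * map (algebraMap D E) (g j) := by
    intro z
    induction z with
    | zero => simp
    | add x y hx hy => simp only [map_add, hx, hy, Pi.add_apply, add_mul, Finset.sum_add_distrib]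
    | tmul e s =>
      simp [hθ, al, hw, Finset.smul_sum]
  have hz0 : v.lTensor E z = 0 := by
    apply hinj
    rw [map_zero]
    apply al.injective
    rw [map_zero, ← hh, ← hcomm, ← LinearMap.lTensor_comp_apply]
    rfl
  obtain ⟨y, rfl⟩ := (hex z).1 hz0
  clear hz0 hh
  induction y with
  | zero => simp
  | add x y hx hy => rw [map_add, map_add]; exact Submodule.add_mem _ hx hy
  | tmul e s =>
    rw [LinearMap.lTensor_tmul]
    have : θ (e ⊗ₜ (LinearMap.ker v).subtype s) =
        (C e : MvPolynomial σ E) • fun j => map (algebraMap D E) (s.1 j) := by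
      ext1 j
      rw [hθ]
      simp [MvPolynomial.smul_eq_C_mul]
    rw [this]
    refine Submodule.smul_mem _ _ (Submodule.subset_span ⟨s.1, ?_, rfl⟩)
    rw [← hw]
    exact congrArg Subtype.val (LinearMap.mem_ker.1 s.2)

theorem ffst_core {A1 D E F σ ι κ : Type*} [Fintype ι] [Fintype κ] [CommRing A1] [CommRing D]
    [CommRing E] [CommRing F] [Algebra D E] [Algebra D F] [Module.FaithfullyFlat D F]
    (q1 : A1 →+* E) (hq1 : Function.Surjective q1) (f1 : A1) (hker : ∀ r, q1 r = 0 ↔ f1 ∣ r)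
    (hreg : ∀ p p' : MvPolynomial σ A1, C f1 * p = C f1 * p' → p = p')
    (π : MvPolynomial σ D →ₐ[D] F) (hπ : Function.Surjective π)
    (g : ι → MvPolynomial σ D) (hg : RingHom.ker π = Ideal.span (Set.range g))
    (G : ι → MvPolynomial σ A1) (hG : ∀ j, map q1 (G j) = map (algebraMap D E) (g j))
    (s : κ → ι → MvPolynomial σ D)
    (hs : ∀ t : ι → MvPolynomial σ D, ∑ j, t j * g j = 0 →
      t ∈ Submodule.span (MvPolynomial σ D) (Set.range s))
    (Z : κ → ι → MvPolynomial σ A1) (hZ : ∀ k, ∑ j, Z k j * G j = 0)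
    (hZs : ∀ k j, map q1 (Z k j) = map (algebraMap D E) (s k j))
    (N : ℕ) (y : A1) (p1 : MvPolynomial σ A1)
    (hy : C (f1 ^ N) * (C y - C f1 * p1) ∈ Ideal.span (Set.range G)) : f1 ∣ y := by
  have step : ∀ p : MvPolynomial σ A1, C f1 * p ∈ Ideal.span (Set.range G) →
      p ∈ Ideal.span (Set.range G) := by
    intro p hp
    obtain ⟨h, hh⟩ := (Submodule.mem_span_range_iff_exists_fun _).1 hp
    simp only [smul_eq_mul] at hh
    have h0 : ∑ j, map q1 (h j) * map (algebraMap D E) (g j) = 0 := by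
      have := congrArg (map q1) hh
      simp only [map_sum, map_mul, map_C, (hker f1).2 dvd_rfl, zero_mul, hG, C_0] at this
      exact this
    have h1 := ffst_syz π hπ g hg (fun j => map q1 (h j)) h0
    have h2 : (fun j => map q1 (h j)) ∈ Submodule.span (MvPolynomial σ E)
        (Set.range fun k => fun j => map (algebraMap D E) (s k j)) := by
      refine (Submodule.span_le.2 ?_) h1
      rintro _ ⟨t, ht, rfl⟩
      obtain ⟨d, rfl⟩ := (Submodule.mem_span_range_iff_exists_fun _).1 (hs t ht)
      refine (Submodule.mem_span_range_iff_exists_fun _).2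
        ⟨fun k => map (algebraMap D E) (d k), ?_⟩
      ext1 j
      simp [Finset.sum_apply]
    obtain ⟨r, hr⟩ := (Submodule.mem_span_range_iff_exists_fun _).1 h2
    choose r' hr' using fun k => MvPolynomial.map_surjective q1 hq1 (r k)
    have h3 : ∀ j, C f1 ∣ h j - ∑ k, r' k * Z k j := by
      intro j
      rw [MvPolynomial.C_dvd_iff_map_hom_eq_zero q1 f1 hker]
      have := congrFun hr j
      simp only [Finset.sum_apply, Pi.smul_apply, smul_eq_mul] at this
      simp only [map_sub, map_sum, map_mul, hr', hZs, this, sub_self]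
    choose h' hh' using h3
    have h4 : p = ∑ j, h' j * G j := by
      apply hreg
      rw [Finset.mul_sum, ← hh]
      have h5 : ∑ j, (∑ k, r' k * Z k j) * G j = 0 := by
        simp only [Finset.sum_mul]
        rw [Finset.sum_comm]
        simp only [mul_assoc, ← Finset.mul_sum, hZ, mul_zero, Finset.sum_const_zero]
      simp only [← mul_assoc, ← hh', sub_mul, Finset.sum_sub_distrib, h5, sub_zero]
    rw [h4]
    exact Ideal.sum_mem _ fun j _ => Ideal.mul_mem_left _ _ (Ideal.subset_span ⟨j, rfl⟩)
  have steps : ∀ N : ℕ, ∀ p : MvPolynomial σ A1, C (f1 ^ N) * p ∈ Ideal.span (Set.range G) →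
      p ∈ Ideal.span (Set.range G) := by
    intro N
    induction N with
    | zero => intro p hp; simpa using hp
    | succ N ih =>
      intro p hp
      apply ih
      apply step
      rw [pow_succ', C_mul, mul_assoc] at hp
      exact hp
  have h6 := steps N _ hy
  rw [← hker]
  refine ffst_const π g (fun j => ?_) (q1 y) ?_
  · rw [← RingHom.mem_ker, hg]; exact Ideal.subset_span ⟨j, rfl⟩
  · have h7 := Ideal.mem_map_of_mem (map q1) h6
    rw [Ideal.map_span, ← Set.range_comp] at h7
    simp only [map_sub, map_mul, map_C, (hker f1).2 dvd_rfl, zero_mul, C_0, sub_zero] at h7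
    convert h7 using 4
    exact (hG _).symm

theorem ffst_retract {R F L : Type*} [CommRing R] [Field F] [Field L] [Algebra R F] [Algebra F L]
    [Algebra R L] [IsScalarTower R F L] [Algebra.IsAlgebraic F L] (s : Finset L) :
    ∃ T : Finset F, ∀ y : F, algebraMap F L y ∈ Algebra.adjoin R (s : Set L) →
      y ∈ Algebra.adjoin R (T : Set F) := by
  classical
  have hfin : (Subalgebra.toSubmodule (Algebra.adjoin F (s : Set L))).FG :=
    fg_adjoin_of_finite s.finite_toSet fun x _ => (Algebra.IsAlgebraic.isAlgebraic x).isIntegral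
  obtain ⟨k, e, he⟩ := Submodule.fg_iff_exists_fin_generating_family.1 hfin
  have hspan : ∀ y ∈ Algebra.adjoin F (s : Set L), ∃ c : Fin k → F, ∑ i, c i • e i = y := by
    intro y hy
    apply (Submodule.mem_span_range_iff_exists_fun _).1
    rw [he]; exact hy
  have heW : ∀ i, e i ∈ Algebra.adjoin F (s : Set L) := by
    intro i
    rw [← Subalgebra.mem_toSubmodule, ← he]
    exact Submodule.subset_span ⟨i, rfl⟩
  obtain ⟨u, hu⟩ := hspan 1 (one_mem _)
  have hx : ∀ (x : s) (j : Fin k), ∃ c : Fin k → F, ∑ i, c i • e i = x.1 * e j := fun x j =>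
    hspan _ (mul_mem (Algebra.subset_adjoin x.2) (heW j))
  choose c hc using hx
  obtain ⟨φ, hφ⟩ := LinearMap.exists_leftInverse_of_injective (Algebra.linearMap F L)
    (LinearMap.ker_eq_bot.2 (algebraMap F L).injective)
  have hφ' : ∀ y : F, φ (algebraMap F L y) = y := fun y => LinearMap.congr_fun hφ y
  let T : Finset F := (Finset.univ.image u) ∪ (Finset.univ.image fun i => φ (e i)) ∪
    (Finset.univ.image fun t : s × Fin k × Fin k => c t.1 t.2.1 t.2.2)
  refine ⟨T, fun y hy => ?_⟩
  set Q := Algebra.adjoin R (T : Set F) with hQ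
  have hTQ : ∀ t ∈ T, t ∈ Q := fun t ht => Algebra.subset_adjoin ht
  have huQ : ∀ i, u i ∈ Q := fun i => hTQ _ (by simp [T])
  have hφQ : ∀ i, φ (e i) ∈ Q := fun i => hTQ _ (by simp [T])
  have hcQ : ∀ x i j, c x i j ∈ Q := fun x i j => hTQ _ (by
    apply Finset.mem_union_right
    exact Finset.mem_image.2 ⟨(x, i, j), Finset.mem_univ _, rfl⟩)
  let N : Submodule Q L := Submodule.span Q (Set.range e)
  have hsum : ∀ d : Fin k → F, (∀ i, d i ∈ Q) → ∑ i, d i • e i ∈ N := by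
    intro d hd
    refine Submodule.sum_mem _ fun i _ => ?_
    exact Submodule.smul_mem N (⟨d i, hd i⟩ : Q) (Submodule.subset_span ⟨i, rfl⟩)
  have h1 : (1 : L) ∈ N := hu ▸ hsum u huQ
  have hmul : ∀ b ∈ Algebra.adjoin R (s : Set L), ∀ n ∈ N, b * n ∈ N := by
    intro b hb
    induction hb using Algebra.adjoin_induction with
    | mem x hx =>
      intro n hn
      induction hn using Submodule.span_induction with
      | mem n hn =>
        obtain ⟨j, rfl⟩ := hn
        rw [← hc ⟨x, hx⟩ j]
        exact hsum _ (hcQ _ _)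
      | zero => simp
      | add a b _ _ ha hb => rw [mul_add]; exact add_mem ha hb
      | smul q n _ hn => rw [mul_smul_comm]; exact Submodule.smul_mem _ _ hn
    | algebraMap r =>
      intro n hn
      have : algebraMap R L r * n = (algebraMap R Q r) • n := by
        rw [Algebra.smul_def, ← IsScalarTower.algebraMap_apply R Q L]
      rw [this]; exact Submodule.smul_mem _ _ hn
    | add a b _ _ ha hb => intro n hn; rw [add_mul]; exact add_mem (ha n hn) (hb n hn)
    | mul a b _ _ ha hb => intro n hn; rw [mul_assoc]; exact ha _ (hb n hn)
  have hφN : ∀ n ∈ N, φ n ∈ Q := by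
    intro n hn
    induction hn using Submodule.span_induction with
    | mem n hn => obtain ⟨j, rfl⟩ := hn; exact hφQ j
    | zero => simp
    | add a b _ _ ha hb => rw [map_add]; exact add_mem ha hb
    | smul q n _ hn =>
      have : q • n = (q : F) • n := rfl
      rw [this, map_smul]; exact mul_mem q.2 hn
  have := hφN _ (hmul _ hy 1 h1)
  rwa [mul_one, hφ'] at this

theorem ffst_clear {R A ι : Type*} [CommRing R] [CommRing A] [IsDomain A] [Algebra R A]
    (m : MonomialOrder ι) (T : Finset (FractionRing (MvPolynomial ι A)))
    (hT : ∀ a : A, algebraMap (MvPolynomial ι A) (FractionRing (MvPolynomial ι A)) (C a) ∈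
      Algebra.adjoin R (T : Set (FractionRing (MvPolynomial ι A)))) :
    ∃ f : A, f ≠ 0 ∧ ∃ A0 : Subalgebra R A, A0.FG ∧ ∀ a, ∃ n, f ^ n * a ∈ A0 := by
  classical
  obtain ⟨⟨h, hh⟩, hd⟩ := IsLocalization.exist_integer_multiples_of_finset
    (nonZeroDivisors (MvPolynomial ι A)) T
  have hh0 : h ≠ 0 := nonZeroDivisors.ne_zero hh
  have hd' : ∀ t : T, ∃ p : MvPolynomial ι A, algebraMap _ (FractionRing (MvPolynomial ι A)) p =
      algebraMap _ (FractionRing (MvPolynomial ι A)) h * t.1 := by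
    intro t
    obtain ⟨p, hp⟩ := hd t.1 t.2
    exact ⟨p, by rw [hp, Algebra.smul_def]⟩
  choose p hp using hd'
  let S : Finset A := h.coeffs ∪ Finset.univ.biUnion fun t => (p t).coeffs
  let A0 := Algebra.adjoin R (S : Set A)
  let M : Subalgebra R (MvPolynomial ι A) := (MvPolynomial.mapAlgHom (σ := ι) A0.val).range
  have hM : ∀ q : MvPolynomial ι A, (∀ i, coeff i q ∈ A0) ↔ q ∈ M := by
    intro q
    constructor
    · intro hq
      have : q ∈ Set.range (MvPolynomial.map (σ := ι) (A0.val : A0 →+* A)) := by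
        rw [MvPolynomial.mem_range_map_iff_coeffs_subset]
        intro c hc
        obtain ⟨i, _, rfl⟩ := MvPolynomial.mem_coeffs_iff.1 hc
        exact ⟨⟨_, hq i⟩, rfl⟩
      obtain ⟨q', hq'⟩ := this
      exact ⟨q', hq'⟩
    · rintro ⟨q', rfl⟩ i
      simp only [MvPolynomial.mapAlgHom_apply, RingHom.coe_coe, AlgHom.toRingHom_eq_coe]
      erw [MvPolynomial.coeff_map]
      exact (coeff i q').2
  have hcoef : ∀ q : MvPolynomial ι A, (q.coeffs ⊆ S) → q ∈ M := by
    intro q hq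
    rw [← hM]
    intro i
    by_cases h0 : coeff i q = 0
    · rw [h0]; exact zero_mem _
    · exact Algebra.subset_adjoin (hq (MvPolynomial.mem_coeffs_iff.2
        ⟨i, MvPolynomial.mem_support_iff.2 h0, rfl⟩))
  have hhM : h ∈ M := hcoef h Finset.subset_union_left
  have hpM : ∀ t, p t ∈ M := fun t => hcoef _ fun x hx => Finset.mem_union_right _
    (Finset.mem_biUnion.2 ⟨t, Finset.mem_univ _, hx⟩)
  have key : ∀ q ∈ Algebra.adjoin R (T : Set (FractionRing (MvPolynomial ι A))),
      ∃ n : ℕ, ∃ r ∈ M, algebraMap _ (FractionRing (MvPolynomial ι A)) r =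
        algebraMap _ (FractionRing (MvPolynomial ι A)) h ^ n * q := by
    intro q hq
    induction hq using Algebra.adjoin_induction with
    | mem x hx => exact ⟨1, p ⟨x, hx⟩, hpM _, by rw [hp, pow_one]⟩
    | algebraMap r =>
      refine ⟨0, algebraMap R _ r, Subalgebra.algebraMap_mem _ _, ?_⟩
      rw [pow_zero, one_mul, ← IsScalarTower.algebraMap_apply]
    | add a b _ _ ha hb =>
      obtain ⟨n, r, hr, h1⟩ := ha
      obtain ⟨n', r', hr', h2⟩ := hb
      refine ⟨n + n', h ^ n' * r + h ^ n * r', add_mem (mul_mem (pow_mem hhM _) hr)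
        (mul_mem (pow_mem hhM _) hr'), ?_⟩
      simp only [map_add, map_mul, map_pow, h1, h2]; ring
    | mul a b _ _ ha hb =>
      obtain ⟨n, r, hr, h1⟩ := ha
      obtain ⟨n', r', hr', h2⟩ := hb
      refine ⟨n + n', r * r', mul_mem hr hr', ?_⟩
      simp only [map_mul, h1, h2]; ring
  refine ⟨m.leadingCoeff h, by simpa using hh0, A0, Subalgebra.fg_adjoin_finset _, fun a => ?_⟩
  obtain ⟨n, r, hr, hra⟩ := key _ (hT a)
  refine ⟨n, ?_⟩
  have hr2 : r = h ^ n * C a := by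
    apply IsFractionRing.injective (MvPolynomial ι A) (FractionRing (MvPolynomial ι A))
    rw [hra]; simp
  have : m.leadingCoeff r = m.leadingCoeff h ^ n * a := by
    rw [hr2, MonomialOrder.leadingCoeff_mul, MonomialOrder.leadingCoeff_pow,
      MonomialOrder.leadingCoeff_C]
  rw [← this]
  exact (hM r).2 hr _

theorem ffst_generic {R A L : Type*} [CommRing R] [CommRing A] [IsDomain A] [Field L]
    [Algebra R A] [Algebra A L] [Algebra R L] [IsScalarTower R A L] [FaithfulSMul A L]
    (s : Finset L) (hs : ∀ a, algebraMap A L a ∈ Algebra.adjoin R (s : Set L)) :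
    ∃ f : A, f ≠ 0 ∧ ∃ A0 : Subalgebra R A, A0.FG ∧ ∀ a, ∃ n, f ^ n * a ∈ A0 := by
  classical
  obtain ⟨ι₀, x₀, hx₀⟩ := exists_isTranscendenceBasis' A L
  let : LinearOrder ι₀ := linearOrderOfSTO WellOrderingRel
  have : WellFoundedLT ι₀ := ⟨(inferInstance : IsWellFounded ι₀ WellOrderingRel).wf⟩
  let ι := ι₀ᵒᵈ
  let x : ι → L := x₀ ∘ OrderDual.ofDual
  have hx : IsTranscendenceBasis A x := hx₀.comp_equiv OrderDual.ofDual
  let P := MvPolynomial ι A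
  let : Algebra P L := (aeval x : P →ₐ[A] L).toAlgebra
  have : FaithfulSMul P L := (faithfulSMul_iff_algebraMap_injective P L).2 hx.1
  have : IsScalarTower A P L := IsScalarTower.of_algebraMap_eq fun a => by
    change _ = aeval x (C a); simp
  have : Algebra.IsAlgebraic P L := by
    have := hx.isAlgebraic
    refine Algebra.IsAlgebraic.of_ringHom_of_comp_eq (S := Algebra.adjoin A (Set.range x)) (B := L)
      (hx.1.aevalEquiv : P →+* Algebra.adjoin A (Set.range x)) (RingHom.id L)
      hx.1.aevalEquiv.surjective Function.injective_id ?_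
    exact RingHom.ext fun p => hx.1.algebraMap_aevalEquiv p
  let : Algebra (FractionRing P) L := FractionRing.liftAlgebra P L
  have : IsScalarTower P (FractionRing P) L := FractionRing.isScalarTower_liftAlgebra P L
  have : IsScalarTower A (FractionRing P) L := IsScalarTower.of_algebraMap_eq fun a => by
    rw [IsScalarTower.algebraMap_apply A P L, IsScalarTower.algebraMap_apply P (FractionRing P) L,
      ← IsScalarTower.algebraMap_apply A P]
  have : IsScalarTower R (FractionRing P) L := IsScalarTower.of_algebraMap_eq fun a => by
    rw [IsScalarTower.algebraMap_apply R A L, IsScalarTower.algebraMap_apply A (FractionRing P) L,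
      ← IsScalarTower.algebraMap_apply R A (FractionRing P)]
  have : Algebra.IsAlgebraic (FractionRing P) L := 
    Algebra.IsAlgebraic.extendScalars (IsFractionRing.injective P (FractionRing P))
  obtain ⟨T, hT⟩ := ffst_retract (R := R) (F := FractionRing P) s
  refine ffst_clear (MonomialOrder.lex (σ := ι)) T fun a => hT _ ?_
  rw [← IsScalarTower.algebraMap_apply P (FractionRing P) L]
  have : algebraMap P L (C a) = algebraMap A L a := (IsScalarTower.algebraMap_apply A P L a).symm
  rw [this]; exact hs a

theorem ffst_lift {R A σ : Type*} [CommRing R] [CommRing A] [Algebra R A] (S : Subalgebra R A)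
    (p : MvPolynomial σ A) (h : ∀ i, coeff i p ∈ S) :
    ∃ p' : MvPolynomial σ S, map S.val.toRingHom p' = p := by
  have : p ∈ Set.range (MvPolynomial.map (σ := σ) S.val.toRingHom) := by
    rw [MvPolynomial.mem_range_map_iff_coeffs_subset]
    intro c hc
    obtain ⟨i, _, rfl⟩ := MvPolynomial.mem_coeffs_iff.1 hc
    exact ⟨⟨_, h i⟩, rfl⟩
  exact this

theorem ffst_coeff_mem {R A σ : Type*} [CommRing R] [CommRing A] [Algebra R A]
    (S : Subalgebra R A) (p : MvPolynomial σ A) (h : (p.coeffs : Set A) ⊆ S) (i : σ →₀ ℕ) :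
    coeff i p ∈ S := by
  by_cases h0 : coeff i p = 0
  · rw [h0]; exact zero_mem _
  · exact h (MvPolynomial.mem_coeffs_iff.2 ⟨i, MvPolynomial.mem_support_iff.2 h0, rfl⟩)

theorem ffst_quot_lift {R A : Type*} [CommRing R] [CommRing A] [Algebra R A] (I : Ideal A)
    (h : Algebra.FiniteType R (A ⧸ I)) :
    ∃ S : Subalgebra R A, S.FG ∧ ∀ a, ∃ b ∈ S, a - b ∈ I := by
  classical
  obtain ⟨s, hs⟩ := h.out
  choose t ht using fun y : s => Ideal.Quotient.mk_surjective (I := I) y.1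
  let S := Algebra.adjoin R (Set.range t)
  refine ⟨S, Subalgebra.fg_def.2 ⟨_, Set.finite_range t, rfl⟩, fun a => ?_⟩
  have h1 : S.map (Ideal.Quotient.mkₐ R I) = ⊤ := by
    rw [AlgHom.map_adjoin, eq_top_iff, ← hs]
    apply Algebra.adjoin_mono
    intro y hy
    exact ⟨t ⟨y, hy⟩, ⟨_, rfl⟩, ht _⟩
  have h2 : Ideal.Quotient.mkₐ R I a ∈ S.map (Ideal.Quotient.mkₐ R I) := by rw [h1]; trivial
  obtain ⟨b, hb, hab⟩ := h2
  exact ⟨b, hb, Ideal.Quotient.eq.1 hab.symm⟩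

theorem ffst_ff_quot {A B : Type*} [CommRing A] [CommRing B] [Algebra A B]
    [Module.FaithfullyFlat A B] (I : Ideal A) :
    Module.FaithfullyFlat (A ⧸ I) (B ⧸ I.map (algebraMap A B)) :=
  Module.FaithfullyFlat.of_linearEquiv (A ⧸ I) ((A ⧸ I) ⊗[A] B)
    (Algebra.TensorProduct.quotIdealMapEquivQuotTensor B I).toLinearEquiv

theorem ffst_map_sub {A E σ : Type*} [CommRing A] [CommRing E] (q : A →+* E) (f : A)
    (h : q f = 0) (p r : MvPolynomial σ A) : map q (p - C f * r) = map q p := by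
  simp [h]

theorem ffst_map_comp {A0 A D E σ : Type*} [CommRing A0] [CommRing A] [CommRing D] [CommRing E]
    (ψ : A0 →+* D) (i : A0 →+* A) (q : A →+* E) (δ : D →+* E) (h : δ.comp ψ = q.comp i)
    (p : MvPolynomial σ A0) : map δ (map ψ p) = map q (map i p) := by
  rw [MvPolynomial.map_map, MvPolynomial.map_map, h]

theorem ffst_fiber {R A B D F : Type*} [CommRing R] [CommRing A] [CommRing B] [CommRing D]
    [CommRing F] [Algebra R A] [Algebra A B] [Algebra D F] {n m : ℕ}
    (x : Fin n → B) (f : A) (q : A →+* D) (hqs : Function.Surjective q) (hqf : q f = 0)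
    (qB : B →+* F) (hqBs : Function.Surjective qB)
    (hqB : ∀ b, qB b = 0 → algebraMap A B f ∣ b)
    (hcomp : ∀ a, algebraMap D F (q a) = qB (algebraMap A B a))
    (hπR : ∀ b, ∃ p : MvPolynomial (Fin n) R,
      aeval (R := A) x (map (algebraMap R A) p) = b)
    (g : Fin m → MvPolynomial (Fin n) A) (hgJ : ∀ j, aeval x (g j) = 0)
    (hJ : ∀ p : MvPolynomial (Fin n) A, aeval x p = 0 →
      ∃ h : Fin m → MvPolynomial (Fin n) A, ∑ j, h j * g j = p) :
    Function.Surjective (aeval (R := D) (fun i => qB (x i))) ∧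
    RingHom.ker (aeval (R := D) (fun i => qB (x i))) =
      Ideal.span (Set.range fun j => map q (g j)) := by
  have hπb : ∀ p, aeval (R := D) (fun i => qB (x i)) (map q p) = qB (aeval x p) := by
    intro p
    induction p using MvPolynomial.induction_on with
    | C a => simp [hcomp]
    | add a b ha hb => simp only [map_add, ha, hb]
    | mul_X a i ha => simp only [map_mul, ha, map_X, aeval_X]
  constructor
  · intro y
    obtain ⟨b, rfl⟩ := hqBs y
    obtain ⟨p, hp⟩ := hπR b
    exact ⟨map q (map (algebraMap R A) p), by rw [hπb, hp]⟩
  · apply le_antisymm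
    · intro p hp
      obtain ⟨p, rfl⟩ := MvPolynomial.map_surjective q hqs p
      rw [RingHom.mem_ker, hπb] at hp
      obtain ⟨b, hb⟩ := hqB _ hp
      obtain ⟨r, rfl⟩ := hπR b
      obtain ⟨h, hh⟩ := hJ (p - C f * map (algebraMap R A) r) (by
        rw [map_sub, map_mul, hb]; simp)
      have h5 := congrArg (map q) hh
      rw [ffst_map_sub q f hqf, map_sum] at h5
      rw [← h5]
      refine Ideal.sum_mem _ fun j _ => ?_
      rw [map_mul]
      exact Ideal.mul_mem_left _ _ (Ideal.subset_span ⟨j, rfl⟩)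
    · rw [Ideal.span_le]
      rintro _ ⟨j, rfl⟩
      change aeval (R := D) (fun i => qB (x i)) (map q (g j)) = 0
      rw [hπb, hgJ, map_zero]

theorem ffst_hlift {A00 A B D : Type*} [CommRing A00] [CommRing A] [CommRing B] [CommRing D]
    [Algebra A B] {n m : ℕ} (x : Fin n → B) (f : A) (q : A →+* D) (hqf : ∀ r, q r = 0 ↔ f ∣ r)
    (hfB : ∀ b : B, f • b = 0 → b = 0) (i0 : A00 →+* A)
    (g : Fin m → MvPolynomial (Fin n) A) (hgJ : ∀ j, aeval x (g j) = 0)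
    (hJ : ∀ p : MvPolynomial (Fin n) A, aeval x p = 0 →
      ∃ h : Fin m → MvPolynomial (Fin n) A, ∑ j, h j * g j = p)
    (S : Fin m → MvPolynomial (Fin n) A00) (s : Fin m → MvPolynomial (Fin n) D)
    (hS : ∀ j, map (q.comp i0) (S j) = s j) (hs1 : ∑ j, s j * map q (g j) = 0) :
    ∃ h : Fin m → MvPolynomial (Fin n) A, ∑ j, (map i0 (S j) - C f * h j) * g j = 0 := by
  have h3 : C f ∣ ∑ j, map i0 (S j) * g j := by
    rw [MvPolynomial.C_dvd_iff_map_hom_eq_zero q f hqf, ← hs1]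
    simp only [map_sum, map_mul, MvPolynomial.map_map]
    exact Finset.sum_congr rfl fun j _ => by rw [← hS]
  obtain ⟨p, hp⟩ := h3
  have h4 : aeval x p = 0 := by
    apply hfB
    have := congrArg (aeval x) hp
    simp only [map_sum, map_mul, hgJ, mul_zero, Finset.sum_const_zero] at this
    rw [Algebra.smul_def, this]
    simp
  obtain ⟨h, hh⟩ := hJ p h4
  refine ⟨h, ?_⟩
  simp only [sub_mul, Finset.sum_sub_distrib, mul_assoc, ← Finset.mul_sum, hh, hp, sub_self]

theorem ffst_key {A00 A1 A D E F : Type*} [CommRing A00] [CommRing A1] [CommRing A]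
    [CommRing D] [CommRing E] [CommRing F] [Algebra D F] [Module.FaithfullyFlat D F]
    {n m k : ℕ} (f : A) (hf : IsRegular f) (i0 : A00 →+* A) (i1 : A1 →+* A)
    (hi1 : Function.Injective i1) (i01 : A00 →+* A1) (hi01 : i1.comp i01 = i0)
    (f1 : A1) (hif1 : i1 f1 = f) (q : A →+* D) (q1 : A1 →+* E) (hq1s : Function.Surjective q1)
    (hq1 : ∀ r, q1 r = 0 ↔ f1 ∣ r) (δ : D →+* E) (hδ : δ.comp (q.comp i0) = q1.comp i01)
    (πb : MvPolynomial (Fin n) D →ₐ[D] F) (hπbs : Function.Surjective πb)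
    (g : Fin m → MvPolynomial (Fin n) A)
    (hπbk : RingHom.ker πb = Ideal.span (Set.range fun j => map q (g j)))
    (g0 : Fin m → MvPolynomial (Fin n) A00) (hg0 : ∀ j, map i0 (g0 j) = g j)
    (s : Fin k → Fin m → MvPolynomial (Fin n) D)
    (hs2 : ∀ t : Fin m → MvPolynomial (Fin n) D, ∑ j, t j * map q (g j) = 0 →
      t ∈ Submodule.span (MvPolynomial (Fin n) D) (Set.range s))
    (S : Fin k → Fin m → MvPolynomial (Fin n) A00)
    (hS : ∀ i j, map (q.comp i0) (S i j) = s i j)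
    (h1 : Fin k → Fin m → MvPolynomial (Fin n) A1)
    (hh1 : ∀ i, ∑ j, (map i0 (S i j) - C f * map i1 (h1 i j)) * g j = 0)
    (y : A1) (p1 : MvPolynomial (Fin n) A1) (v : Fin m → MvPolynomial (Fin n) A1) (N : ℕ)
    (hv : ∑ j, map i1 (v j) * g j = C (f ^ N) * map i1 (C y - C f1 * p1)) : f1 ∣ y := by
  let : Algebra D E := δ.toAlgebra
  have hmi1 : Function.Injective (map (σ := Fin n) i1) := MvPolynomial.map_injective _ hi1
  have hGi : ∀ j, map i1 (map i01 (g0 j)) = g j := fun j => by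
    rw [MvPolynomial.map_map, hi01, hg0]
  refine ffst_core q1 hq1s f1 hq1 ?_ πb hπbs (fun j => map q (g j)) hπbk
    (fun j => map i01 (g0 j)) ?_ s hs2 (fun i j => map i01 (S i j) - C f1 * h1 i j) ?_ ?_ N y p1 ?_
  · intro p p' hp
    ext e
    have := congrArg (coeff e) hp
    rw [coeff_C_mul, coeff_C_mul] at this
    have h8 := congrArg i1 this
    rw [map_mul, map_mul, hif1] at h8
    exact hi1 (hf.left h8)
  · intro j
    change _ = map δ _
    rw [← hg0 j, MvPolynomial.map_map i0 q]
    exact (ffst_map_comp _ i01 q1 δ hδ (g0 j)).symm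
  · intro i
    apply hmi1
    rw [map_zero, ← hh1 i]
    simp only [map_sum, map_mul, hGi, map_sub, map_C, MvPolynomial.map_map, hi01, hif1]
  · intro i j
    change _ = map δ _
    rw [← hS]
    exact (ffst_map_sub q1 f1 ((hq1 f1).2 dvd_rfl) _ _).trans
      (ffst_map_comp _ i01 q1 δ hδ (S i j)).symm
  · have h6 : C (f1 ^ N) * (C y - C f1 * p1) = ∑ j, v j * map i01 (g0 j) := by
      apply hmi1
      rw [map_mul, map_C, map_pow, hif1, ← hv, map_sum]
      refine Finset.sum_congr rfl fun j _ => ?_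
      rw [map_mul, hGi]
    rw [h6]
    exact Ideal.sum_mem _ fun j _ => Ideal.mul_mem_left _ _ (Ideal.subset_span ⟨j, rfl⟩)

theorem ffst_factor {A D E : Type*} [CommRing A] [CommRing D] [CommRing E] (ψ : A →+* D)
    (hψ : Function.Surjective ψ) (φ : A →+* E) (h : RingHom.ker ψ ≤ RingHom.ker φ) :
    ∃ δ : D →+* E, δ.comp ψ = φ :=
  ⟨RingHom.liftOfSurjective ψ hψ ⟨φ, h⟩, RingHom.liftOfRightInverse_comp _ _ _ _⟩

theorem ffst_kerle {A D E ι : Type*} [CommRing A] [CommRing D] [CommRing E] (ψ : A →+* D)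
    (φ : A →+* E) (t : ι → A) (ht : Submodule.span A (Set.range t) = RingHom.ker ψ)
    (h : ∀ i, φ (t i) = 0) : RingHom.ker ψ ≤ RingHom.ker φ := by
  rw [← ht]
  refine Submodule.span_le.2 ?_
  rintro _ ⟨i, rfl⟩
  exact h i

theorem ffst_incl {R A : Type*} [CommRing R] [CommRing A] [Algebra R A] (S T : Subalgebra R A)
    (h : S ≤ T) :
    T.val.toRingHom.comp (Subalgebra.inclusion h).toRingHom = S.val.toRingHom := rfl

theorem ffst_away {R A B : Type*} [CommRing R] [CommRing A] [CommRing B] [IsNoetherianRing R]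
    [IsNoetherianRing A] [Algebra R A] [Algebra R B] [Algebra A B] [IsScalarTower R A B]
    [Module.FaithfullyFlat A B] (hB : Algebra.FiniteType R B) (f : A) (hf : IsRegular f)
    (A0 : Subalgebra R A) (hA0 : A0.FG) (hfA0 : ∀ a, ∃ n, f ^ n * a ∈ A0)
    (hq : Algebra.FiniteType R (A ⧸ Ideal.span {f})) : Algebra.FiniteType R A := by
  classical
  obtain ⟨n, ρ, hρ⟩ := Algebra.FiniteType.iff_quotient_mvPolynomial''.1 hB
  let x : Fin n → B := fun i => ρ (X i)
  have hρx : ∀ p, ρ p = aeval x p := fun p =>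
    DFunLike.congr_fun (MvPolynomial.aeval_unique ρ) p
  let π : MvPolynomial (Fin n) A →ₐ[A] B := aeval x
  have hπR : ∀ b, ∃ p : MvPolynomial (Fin n) R, π (map (algebraMap R A) p) = b := by
    intro b
    obtain ⟨p, hp⟩ := hρ b
    refine ⟨p, ?_⟩
    rw [← hp, hρx]
    simp only [π, aeval_map_algebraMap]
  obtain ⟨m, g, hg⟩ := Submodule.fg_iff_exists_fin_generating_family.1
    (IsNoetherian.noetherian (RingHom.ker π))
  have hJ : ∀ p, π p = 0 → ∃ h : Fin m → MvPolynomial (Fin n) A, ∑ j, h j * g j = p := by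
    intro p hp
    have : p ∈ Submodule.span (MvPolynomial (Fin n) A) (Set.range g) := by rw [hg]; exact hp
    simpa using (Submodule.mem_span_range_iff_exists_fun _).1 this
  have hgJ : ∀ j, π (g j) = 0 := by
    intro j
    have : g j ∈ RingHom.ker π := by rw [← hg]; exact Submodule.subset_span ⟨j, rfl⟩
    exact this
  obtain ⟨S0, hS0, hS0q⟩ := ffst_quot_lift _ hq
  let T0 : Finset A := insert f (Finset.univ.biUnion fun j => (g j).coeffs)
  obtain ⟨A00, hA00, h0, h1, h2⟩ : ∃ A00 : Subalgebra R A, A00.FG ∧ A0 ≤ A00 ∧ S0 ≤ A00 ∧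
      (T0 : Set A) ⊆ A00 :=
    ⟨A0 ⊔ S0 ⊔ Algebra.adjoin R (T0 : Set A),
      (hA0.sup hS0).sup (Subalgebra.fg_adjoin_finset _), le_sup_left.trans le_sup_left,
      le_sup_right.trans le_sup_left, Algebra.subset_adjoin.trans
        (SetLike.coe_subset_coe.2 (le_sup_right : _ ≤ A0 ⊔ S0 ⊔ Algebra.adjoin R (T0 : Set A)))⟩
  have hf00 : f ∈ A00 := h2 (by simp [T0])
  have hg00 : ∀ j i, coeff i (g j) ∈ A00 := fun j i => ffst_coeff_mem _ _ (fun c hc => h2 (by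
    apply Finset.mem_insert_of_mem
    exact Finset.mem_biUnion.2 ⟨j, Finset.mem_univ _, hc⟩)) i
  choose g0 hg0 using fun j => ffst_lift A00 (g j) (hg00 j)
  have : Algebra.FiniteType R A00 := ⟨(Subalgebra.fg_top _).2 hA00⟩
  have : IsNoetherianRing A00 := Algebra.FiniteType.isNoetherianRing R A00
  let D := A ⧸ Ideal.span {f}
  let q : A →+* D := Ideal.Quotient.mk _
  have hqf : ∀ r, q r = 0 ↔ f ∣ r := fun r => by
    simp only [q]
    rw [Ideal.Quotient.eq_zero_iff_mem, Ideal.mem_span_singleton]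
  let i0 : A00 →+* A := A00.val.toRingHom
  let ψ : A00 →+* D := q.comp i0
  have hψ : Function.Surjective ψ := by
    intro d
    obtain ⟨a, rfl⟩ := Ideal.Quotient.mk_surjective d
    obtain ⟨b, hb, hab⟩ := hS0q a
    exact ⟨⟨b, h1 hb⟩, (Ideal.Quotient.eq.2 hab).symm⟩
  obtain ⟨l, t, ht⟩ := Submodule.fg_iff_exists_fin_generating_family.1
    (IsNoetherian.noetherian (RingHom.ker ψ))
  have htf : ∀ i, ∃ c, (t i : A) = f * c := by
    intro i
    have : t i ∈ RingHom.ker ψ := by rw [← ht]; exact Submodule.subset_span ⟨i, rfl⟩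
    exact (hqf _).1 this
  choose c hc using htf
  let gb : Fin m → MvPolynomial (Fin n) D := fun j => map q (g j)
  obtain ⟨k, s, hs⟩ := Submodule.fg_iff_exists_fin_generating_family.1
    (IsNoetherian.noetherian (LinearMap.ker (Fintype.linearCombination
      (MvPolynomial (Fin n) D) gb)))
  have hs1 : ∀ i, ∑ j, s i j * gb j = 0 := by
    intro i
    have : s i ∈ LinearMap.ker (Fintype.linearCombination (MvPolynomial (Fin n) D) gb) := by
      rw [← hs]; exact Submodule.subset_span ⟨i, rfl⟩
    rw [LinearMap.mem_ker, Fintype.linearCombination_apply] at this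
    simpa using this
  have hs2 : ∀ t : Fin m → MvPolynomial (Fin n) D, ∑ j, t j * gb j = 0 →
      t ∈ Submodule.span (MvPolynomial (Fin n) D) (Set.range s) := by
    intro t ht
    rw [hs, LinearMap.mem_ker, Fintype.linearCombination_apply]
    simpa using ht
  choose S hS using fun i j => MvPolynomial.map_surjective (σ := Fin n) ψ hψ (s i j)
  have hfB : ∀ b : B, f • b = 0 → b = 0 := fun b hb =>
    Module.Flat.isSMulRegular_of_isRegular hf (by simpa using hb)
  have hlift : ∀ i, ∃ h : Fin m → MvPolynomial (Fin n) A,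
      ∑ j, (map i0 (S i j) - C f * h j) * g j = 0 :=
    fun i => ffst_hlift x f q hqf hfB i0 g hgJ hJ (S i) (s i) (hS i) (hs1 i)
  choose hlam hhlam using hlift
  let T1 : Finset A := (Finset.univ.image c) ∪
    (Finset.univ.biUnion fun i => Finset.univ.biUnion fun j => (hlam i j).coeffs)
  obtain ⟨A1, hA1, h01, hT1⟩ : ∃ A1 : Subalgebra R A, A1.FG ∧ A00 ≤ A1 ∧ (T1 : Set A) ⊆ A1 :=
    ⟨A00 ⊔ Algebra.adjoin R (T1 : Set A), hA00.sup (Subalgebra.fg_adjoin_finset _),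
      le_sup_left, Algebra.subset_adjoin.trans
        (SetLike.coe_subset_coe.2 (le_sup_right : _ ≤ A00 ⊔ Algebra.adjoin R (T1 : Set A)))⟩
  have hc1 : ∀ i, c i ∈ A1 := fun i => hT1 (by simp [T1])
  have hh1 : ∀ i j e, coeff e (hlam i j) ∈ A1 := fun i j e =>
    ffst_coeff_mem _ _ (fun c hc => hT1 (by
      apply Finset.mem_union_right
      exact Finset.mem_biUnion.2 ⟨i, Finset.mem_univ _,
        Finset.mem_biUnion.2 ⟨j, Finset.mem_univ _, hc⟩⟩)) e
  choose h1 hh1 using fun i j => ffst_lift A1 (hlam i j) (hh1 i j)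
  let i1 : A1 →+* A := A1.val.toRingHom
  have hi1 : Function.Injective i1 := Subtype.val_injective
  let i01 : A00 →+* A1 := (Subalgebra.inclusion h01).toRingHom
  have hi01 : i1.comp i01 = i0 := ffst_incl _ _ h01
  let f1 : A1 := ⟨f, h01 hf00⟩
  have hif1 : i1 f1 = f := rfl
  let E := A1 ⧸ Ideal.span {f1}
  let q1 : A1 →+* E := Ideal.Quotient.mk _
  have hq1 : ∀ r, q1 r = 0 ↔ f1 ∣ r := fun r => by
    simp only [q1]
    rw [Ideal.Quotient.eq_zero_iff_mem, Ideal.mem_span_singleton]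
  have hkerle : RingHom.ker ψ ≤ RingHom.ker (q1.comp i01) := by
    refine ffst_kerle ψ (q1.comp i01) t ht fun i => ?_
    have h9 : i01 (t i) = f1 * ⟨c i, hc1 i⟩ := Subtype.ext (hc i)
    rw [RingHom.comp_apply, hq1, h9]
    exact Dvd.intro _ rfl
  obtain ⟨δ, hδ⟩ := ffst_factor ψ hψ (q1.comp i01) hkerle
  let F := B ⧸ (Ideal.span {f}).map (algebraMap A B)
  have : Module.FaithfullyFlat D F := ffst_ff_quot _
  have hqs : Function.Surjective q := Ideal.Quotient.mk_surjective
  obtain ⟨hπbs, hπbk⟩ := ffst_fiber (D := D) (F := F) x f q hqs ((hqf f).2 dvd_rfl)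
    (Ideal.Quotient.mk _) Ideal.Quotient.mk_surjective (fun b hb => by
      rwa [Ideal.Quotient.eq_zero_iff_mem, Ideal.map_span,
        Set.image_singleton, Ideal.mem_span_singleton] at hb) (fun a => rfl) hπR g hgJ hJ
  have key : ∀ y : A1, (∃ a, i1 y = f * a) → f1 ∣ y := by
    rintro y ⟨a, ha⟩
    obtain ⟨p, hp⟩ := hπR (algebraMap A B a)
    let p1 : MvPolynomial (Fin n) A1 := map (algebraMap R A1) p
    have hp1 : map i1 p1 = map (algebraMap R A) p := by
      exact MvPolynomial.map_map _ _ _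
    obtain ⟨h, hh⟩ := hJ (map i1 (C y - C f1 * p1)) (by
      rw [map_sub, map_mul, hp1, map_C, map_C, map_sub, map_mul, hp, ha, hif1]; simp [π])
    have hN : ∃ N, ∀ j e, f ^ N * coeff e (h j) ∈ A1 := by
      let U : Finset A := Finset.univ.biUnion fun j => (h j).coeffs
      choose N hN using hfA0
      refine ⟨∑ u ∈ U, N u, fun j e => ?_⟩
      by_cases h0' : coeff e (h j) = 0
      · rw [h0', mul_zero]; exact zero_mem _
      · have hu : coeff e (h j) ∈ U := Finset.mem_biUnion.2 ⟨j, Finset.mem_univ _,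
          MvPolynomial.mem_coeffs_iff.2 ⟨e, MvPolynomial.mem_support_iff.2 h0', rfl⟩⟩
        rw [← Finset.sum_erase_add _ _ hu, pow_add, mul_assoc]
        exact mul_mem (pow_mem (h01 hf00) _) (h01 (h0 (hN _)))
    obtain ⟨N, hN⟩ := hN
    choose v hv using fun j => ffst_lift A1 (C (f ^ N) * h j) (fun e => by
      rw [coeff_C_mul]; exact hN j e)
    refine ffst_key f hf i0 i1 hi1 i01 hi01 f1 hif1 q q1 Ideal.Quotient.mk_surjective hq1 δ hδ _
      hπbs g hπbk g0 hg0 s hs2 S hS h1 (fun i => ?_) y p1 v N ?_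
    · rw [← hhlam i]
      exact Finset.sum_congr rfl fun j _ => by rw [← hh1]
    · rw [← hh, Finset.mul_sum]
      refine Finset.sum_congr rfl fun j _ => ?_
      rw [← mul_assoc, ← hv j]
  have htop : A1 = ⊤ := by
    rw [eq_top_iff]
    intro a _
    obtain ⟨N, hN⟩ := hfA0 a
    have hN' : f ^ N * a ∈ A1 := h01 (h0 hN)
    clear hN
    induction N with
    | zero => simpa using hN'
    | succ N ih =>
      apply ih
      obtain ⟨w, hw⟩ := key ⟨_, hN'⟩ ⟨f ^ N * a, by rw [← mul_assoc, ← pow_succ']; rfl⟩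
      have h7 : f * (f ^ N * a) = f * w := by
        rw [← mul_assoc, ← pow_succ']; exact congrArg Subtype.val hw
      rw [hf.left h7]; exact w.2
  exact ⟨htop ▸ hA1⟩

theorem ffst_step {R A B : Type*} [CommRing R] [CommRing A] [CommRing B] [IsNoetherianRing R]
    [IsNoetherianRing A] [Algebra R A] [Algebra R B] [Algebra A B] [IsScalarTower R A B]
    [Module.FaithfullyFlat A B] (hB : Algebra.FiniteType R B)
    (h : ∀ J : Ideal A, J ≠ ⊥ → Algebra.FiniteType R (A ⧸ J)) : Algebra.FiniteType R A := by
  classical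
  by_cases hn : Nontrivial A
  · by_cases hd : NoZeroDivisors A
    · have : IsDomain A := NoZeroDivisors.to_isDomain A
      obtain ⟨q, hq, hqo⟩ := Ideal.exists_isPrime_liesOver_of_faithfullyFlat (B := B) (⊥ : Ideal A)
      let L := FractionRing (B ⧸ q)
      have hinj : Function.Injective (algebraMap A L) := by
        rw [injective_iff_map_eq_zero]
        intro a ha
        rw [IsScalarTower.algebraMap_apply A (B ⧸ q) L] at ha
        have h1 : algebraMap A (B ⧸ q) a = 0 :=
          (FaithfulSMul.algebraMap_injective (B ⧸ q) L) (by rw [ha, map_zero])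
        have h2 : algebraMap A B a ∈ q := Ideal.Quotient.eq_zero_iff_mem.1 h1
        have h3 : a ∈ q.under A := h2
        rw [← hqo.over] at h3
        exact h3
      have : FaithfulSMul A L := (faithfulSMul_iff_algebraMap_injective A L).2 hinj
      obtain ⟨s, hs⟩ := hB.out
      let φ : B →ₐ[R] L := IsScalarTower.toAlgHom R B L
      obtain ⟨f, hf, A0, hA0, hfA0⟩ := ffst_generic (R := R) (A := A) (L := L) (s.image φ) (by
        intro a
        rw [Finset.coe_image, ← AlgHom.map_adjoin, hs, IsScalarTower.algebraMap_apply A B L]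
        exact ⟨algebraMap A B a, Algebra.mem_top, rfl⟩)
      refine ffst_away hB f (IsRegular.of_ne_zero hf) A0 hA0 hfA0 (h _ ?_)
      simpa using hf
    · have : ∃ a b : A, a * b = 0 ∧ a ≠ 0 ∧ b ≠ 0 := by
        by_contra! hc
        exact hd ⟨fun {a b} hab => by
          by_cases ha : a = 0
          · exact Or.inl ha
          · exact Or.inr (hc a b hab ha)⟩
      obtain ⟨a, b, hab, ha, hb⟩ := this
      obtain ⟨Sa, hSa, hSa'⟩ := ffst_quot_lift _ (h (Ideal.span {a}) (by simpa using ha))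
      obtain ⟨Sb, hSb, hSb'⟩ := ffst_quot_lift _ (h (Ideal.span {b}) (by simpa using hb))
      have hfg : (Sa ⊔ Sb ⊔ Algebra.adjoin R (({b} : Finset A) : Set A)).FG :=
        (hSa.sup hSb).sup (Subalgebra.fg_adjoin_finset _)
      have htop : (Sa ⊔ Sb ⊔ Algebra.adjoin R (({b} : Finset A) : Set A)) = ⊤ := by
        rw [eq_top_iff]
        intro x _
        obtain ⟨y, hy, hxy⟩ := hSb' x
        obtain ⟨c, hc⟩ := Ideal.mem_span_singleton.1 hxy
        obtain ⟨c0, hc0, hcc⟩ := hSa' c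
        obtain ⟨d, hd⟩ := Ideal.mem_span_singleton.1 hcc
        have hx : x = y + b * c0 := by
          linear_combination hc + b * hd + d * hab
        rw [hx]
        have h1 : b ∈ Algebra.adjoin R (({b} : Finset A) : Set A) :=
          Algebra.subset_adjoin (by simp)
        exact add_mem ((le_sup_right.trans le_sup_left : Sb ≤ _) hy)
          (mul_mem ((le_sup_right : _ ≤ Sa ⊔ Sb ⊔ Algebra.adjoin R (({b} : Finset A) : Set A)) h1)
            ((le_sup_left.trans le_sup_left : Sa ≤ _) hc0))
      exact ⟨htop ▸ hfg⟩
  · rw [not_nontrivial_iff_subsingleton] at hn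
    exact ⟨⟨∅, by rw [eq_top_iff]; intro x _; rw [Subsingleton.elim x 0]; exact zero_mem _⟩⟩

theorem ffst_main {R A B : Type*} [CommRing R] [CommRing A] [CommRing B] [IsNoetherianRing R]
    [Algebra R A] [Algebra R B] [Algebra A B] [IsScalarTower R A B]
    [Module.FaithfullyFlat A B] (hB : Algebra.FiniteType R B) : Algebra.FiniteType R A := by
  have : IsNoetherianRing B := Algebra.FiniteType.isNoetherianRing R B
  have : IsNoetherianRing A := (isNoetherianRing_iff_ideal_fg A).2 fun I =>
    Ideal.FG.of_FG_map_of_faithfullyFlat (S := B) (IsNoetherian.noetherian _)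
  have key : ∀ I : Ideal A, Algebra.FiniteType R (A ⧸ I) := by
    intro I
    induction I using IsNoetherian.induction with
    | hgt I ih =>
      change Ideal A at I
      have := ffst_ff_quot (B := B) I
      have : IsScalarTower R (A ⧸ I) (B ⧸ Ideal.map (algebraMap A B) I) := by
        refine IsScalarTower.of_algebraMap_eq fun r => ?_
        rw [IsScalarTower.algebraMap_apply R A (A ⧸ I),
          IsScalarTower.algebraMap_apply R B (B ⧸ Ideal.map (algebraMap A B) I),
          IsScalarTower.algebraMap_apply R A B]
        rfl
      have hB' : Algebra.FiniteType R (B ⧸ Ideal.map (algebraMap A B) I) :=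
        hB.of_surjective (Ideal.Quotient.mkₐ R _) (Ideal.Quotient.mkₐ_surjective R _)
      refine ffst_step hB' fun J hJ => ?_
      have hlt : J.comap (Ideal.Quotient.mk I) > I := by
        refine lt_of_le_of_ne ?_ ?_
        · intro x hx
          rw [Ideal.mem_comap, Ideal.Quotient.eq_zero_iff_mem.2 hx]
          exact zero_mem _
        · intro he
          apply hJ
          rw [eq_bot_iff]
          intro x hx
          obtain ⟨x, rfl⟩ := Ideal.Quotient.mk_surjective x
          have : x ∈ J.comap (Ideal.Quotient.mk I) := hx
          rw [← he] at this
          exact Ideal.Quotient.eq_zero_iff_mem.2 this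
      have h1 := ih _ hlt
      let φ : (A ⧸ J.comap (Ideal.Quotient.mk I)) →ₐ[R] ((A ⧸ I) ⧸ J) :=
        Ideal.quotientMapₐ J (Ideal.Quotient.mkₐ R I) (le_refl _)
      refine h1.of_surjective φ ?_
      intro x
      obtain ⟨x, rfl⟩ := Ideal.Quotient.mk_surjective x
      obtain ⟨x, rfl⟩ := Ideal.Quotient.mk_surjective x
      exact ⟨Ideal.Quotient.mk _ x, rfl⟩
  exact (key ⊥).of_surjective (AlgEquiv.quotientBot R A).toAlgHom
    (AlgEquiv.quotientBot R A).surjective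

end

/-- Let `R` be a Noetherian commutative ring, `B` a finitely generated commutative
`R`-algebra, and `A` an `R`-subalgebra of `B` such that `B` is faithfully flat as an
`A`-module. Then `A` is a finitely generated `R`-algebra. -/
theorem faithfullyFlat_subalgebra_finiteType {R B : Type u} [CommRing R] [CommRing B]
    [IsNoetherianRing R] [Algebra R B] (hB : Algebra.FiniteType R B)
    (A : Subalgebra R B) (hff : Module.FaithfullyFlat A B) :
    Algebra.FiniteType R A := by
  exact ffst_main (B := B) hB
end

section
/- Let A be a Noetherian commutative integral domain and B a finitely generated commutative A-algebra. Then there exists a nonzero element a of A such that the localization B_a = B[1/a] is flat as a module over A_a = A[1/a]. -/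
section GenericFlatness
open TensorProduct

universe u

/-- The multiplication map `I ⊗ M → M`. -/
noncomputable def gfMul {A : Type*} [CommRing A] (I : Ideal A) (M : Type*) [AddCommGroup M]
    [Module A M] : I ⊗[A] M →ₗ[A] M :=
  TensorProduct.lift ((LinearMap.lsmul A M).comp I.subtype)

/-- The kernels of all `I ⊗ M → M` are `a`-power torsion. -/
def GFlat {A : Type*} [CommRing A] (a : A) (M : Type*) [AddCommGroup M] [Module A M] : Prop :=
  ∀ (I : Ideal A) (x : I ⊗[A] M), gfMul I M x = 0 → ∃ n : ℕ, a ^ n • x = 0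

variable {A : Type*} [CommRing A] {M M' M'' : Type*} [AddCommGroup M] [Module A M]
  [AddCommGroup M'] [Module A M'] [AddCommGroup M''] [Module A M'']

theorem gfMul_lTensor (I : Ideal A) (f : M →ₗ[A] M') (x : I ⊗[A] M) :
    gfMul I M' (f.lTensor I x) = f (gfMul I M x) := by
  induction x with
  | zero => simp
  | tmul i m => simp [gfMul]
  | add x y hx hy => simp [hx, hy]

theorem GFlat.mul_right {a : A} (h : GFlat a M) (b : A) : GFlat (a * b) M := by
  intro I x hx
  obtain ⟨n, hn⟩ := h I x hx
  exact ⟨n, by rw [mul_pow, mul_comm, mul_smul, hn, smul_zero]⟩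

theorem GFlat.of_dvd {a b : A} (h : GFlat a M) (hab : a ∣ b) : GFlat b M := by
  obtain ⟨c, rfl⟩ := hab
  exact h.mul_right c

theorem GFlat.of_equiv {a : A} (h : GFlat a M) (e : M ≃ₗ[A] M') : GFlat a M' := by
  intro I x hx
  obtain ⟨n, hn⟩ := h I (e.symm.toLinearMap.lTensor I x) (by rw [gfMul_lTensor, hx, map_zero])
  refine ⟨n, ?_⟩
  have := congrArg (e.toLinearMap.lTensor I) hn
  rw [map_smul, ← LinearMap.comp_apply, ← LinearMap.lTensor_comp] at this
  simpa using this

theorem GFlat.ext {a : A} (f : M' →ₗ[A] M) (g : M →ₗ[A] M'') (hf : Function.Injective f)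
    (hfg : Function.Exact f g) (hg : Function.Surjective g)
    (h' : GFlat a M') (h'' : GFlat a M'') : GFlat a M := by
  intro I x hx
  obtain ⟨n, hn⟩ := h'' I (g.lTensor I x) (by rw [gfMul_lTensor, hx, map_zero])
  rw [← map_smul] at hn
  obtain ⟨y, hy⟩ := (lTensor_exact I hfg hg _).1 hn
  obtain ⟨m, hm⟩ := h' I y (hf (by rw [← gfMul_lTensor, hy, map_smul, hx, smul_zero, map_zero]))
  refine ⟨m + n, ?_⟩
  rw [pow_add, mul_smul, ← hy, ← map_smul, hm, map_zero]

theorem GFlat.of_union {R : Type*} [CommRing R] [Algebra A R] [Module R M] [IsScalarTower A R M]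
    {a : A} (F : ℕ → Submodule R M) (hF : Monotone F) (hU : ∀ m, ∃ k, m ∈ F k)
    (h : ∀ k, GFlat a (F k)) : GFlat a M := by
  intro I x hx
  have key : ∃ k, ∃ y : I ⊗[A] (F k), ((F k).subtype.restrictScalars A).lTensor I y = x := by
    clear hx
    induction x with
    | zero => exact ⟨0, 0, by simp⟩
    | tmul i m =>
      obtain ⟨k, hk⟩ := hU m
      exact ⟨k, i ⊗ₜ ⟨m, hk⟩, by simp⟩
    | add x y hx hy =>
      obtain ⟨k, x, rfl⟩ := hx
      obtain ⟨l, y, rfl⟩ := hy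
      refine ⟨max k l,
        ((Submodule.inclusion (hF (le_max_left k l))).restrictScalars A).lTensor I x +
        ((Submodule.inclusion (hF (le_max_right k l))).restrictScalars A).lTensor I y, ?_⟩
      rw [map_add, ← LinearMap.comp_apply, ← LinearMap.comp_apply, ← LinearMap.lTensor_comp,
        ← LinearMap.lTensor_comp]
      rfl
  obtain ⟨k, y, rfl⟩ := key
  obtain ⟨n, hn⟩ := h k I y (by
    rw [gfMul_lTensor] at hx
    exact Subtype.ext hx)
  exact ⟨n, by rw [← map_smul, hn, map_zero]⟩

/-- The filtration `∑_{i<k} T^i N`. -/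
def gfFil {R : Type*} [CommRing R] [Module R M] (T : Module.End R M) (N : Submodule R M) :
    ℕ → Submodule R M
  | 0 => ⊥
  | k + 1 => gfFil T N k ⊔ N.map (T ^ k)

theorem gfFil_mono {R : Type*} [CommRing R] [Module R M] (T : Module.End R M)
    (N : Submodule R M) : Monotone (gfFil T N) :=
  monotone_nat_of_le_succ fun _ => le_sup_left

theorem gfFil_map {R : Type*} [CommRing R] [Module R M] (T : Module.End R M)
    (N : Submodule R M) (k : ℕ) : (gfFil T N k).map T ≤ gfFil T N (k + 1) := by
  induction k with
  | zero => simp [gfFil]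
  | succ k ih =>
    rw [gfFil, Submodule.map_sup, gfFil]
    refine sup_le_sup ih ?_
    rw [← Submodule.map_comp, pow_succ']
    exact le_rfl

theorem gflat_step {A R M : Type u} [CommRing A] [IsDomain A] [CommRing R] [IsNoetherianRing R]
    [Algebra A R] [AddCommGroup M] [Module A M] [Module R M] [IsScalarTower A R M]
    (hR : ∀ (Q : Type u) [AddCommGroup Q] [Module A Q] [Module R Q] [IsScalarTower A R Q],
      Module.Finite R Q → ∃ a : A, a ≠ 0 ∧ GFlat a Q)
    (T : Module.End R M) (N : Submodule R M) (hN : N.FG)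
    (hU : ∀ m, ∃ k, m ∈ gfFil T N k) : ∃ a : A, a ≠ 0 ∧ GFlat a M := by
  have : Module.Finite R N := Module.Finite.iff_fg.2 hN
  let K : ℕ → Submodule R N := fun k => (gfFil T N k).comap ((T ^ k) ∘ₗ N.subtype)
  have hK : Monotone K := monotone_nat_of_le_succ fun k x hx => by
    change (T ^ (k + 1)) x ∈ gfFil T N (k + 1)
    rw [pow_succ']
    exact gfFil_map T N k ⟨_, hx, rfl⟩
  obtain ⟨n, hn⟩ := monotone_stabilizes_iff_noetherian.2 (inferInstanceAs (IsNoetherian R N))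
    ⟨K, hK⟩
  have hq : ∀ k, ∃ a : A, a ≠ 0 ∧ GFlat a (N ⧸ K k) := fun k => hR _ inferInstance
  choose a ha0 ha using hq
  let b := ∏ k ∈ Finset.range (n + 1), a k
  have hb : ∀ k, GFlat b (N ⧸ K k) := by
    intro k
    rcases le_total k n with hk | hk
    · exact (ha k).of_dvd (Finset.dvd_prod_of_mem a (by simp; omega))
    · have e : K n = K k := hn k hk
      rw [← e]
      exact (ha n).of_dvd (Finset.dvd_prod_of_mem a (by simp))
  refine ⟨b, Finset.prod_ne_zero_iff.2 fun k _ => ha0 k,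
    GFlat.of_union (gfFil T N) (gfFil_mono T N) hU fun k => ?_⟩
  induction k with
  | zero =>
    intro I x hx
    have : Subsingleton (gfFil T N 0) := inferInstanceAs (Subsingleton (⊥ : Submodule R M))
    exact ⟨0, Subsingleton.elim _ _⟩
  | succ k ih =>
    let P := (gfFil T N k).submoduleOf (gfFil T N (k + 1))
    have hle : gfFil T N k ≤ gfFil T N (k + 1) := le_sup_left
    let h : N →ₗ[R] gfFil T N (k + 1) := ((T ^ k) ∘ₗ N.subtype).codRestrict _
      (fun x => Submodule.mem_sup_right ⟨x, x.2, rfl⟩)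
    let g : N →ₗ[R] (gfFil T N (k + 1) ⧸ P) := P.mkQ ∘ₗ h
    have hker : LinearMap.ker g = K k := by
      rw [LinearMap.ker_comp, Submodule.ker_mkQ]
      rfl
    have hsurj : Function.Surjective g := by
      intro y
      obtain ⟨⟨y, hy⟩, rfl⟩ := P.mkQ_surjective y
      obtain ⟨p, hp, q, ⟨z, hz, rfl⟩, rfl⟩ := Submodule.mem_sup.1 hy
      refine ⟨⟨z, hz⟩, ?_⟩
      refine ((Submodule.Quotient.eq P).2 ?_).symm
      change _ ∈ gfFil T N k
      have : p + (T ^ k) z - (T ^ k) z ∈ gfFil T N k := by simpa using hp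
      exact this
    have e : (N ⧸ K k) ≃ₗ[R] (gfFil T N (k + 1) ⧸ P) :=
      (Submodule.quotEquivOfEq _ _ hker.symm).trans (g.quotKerEquivOfSurjective hsurj)
    refine GFlat.ext ((Submodule.inclusion hle).restrictScalars A) (P.mkQ.restrictScalars A)
      (Submodule.inclusion_injective hle) ?_ P.mkQ_surjective ih
      ((hb k).of_equiv (e.restrictScalars A))
    intro y
    change P.mkQ y = 0 ↔ _
    rw [← LinearMap.mem_ker, Submodule.ker_mkQ]
    change (y : M) ∈ gfFil T N k ↔ _
    constructor
    · intro hy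
      exact ⟨⟨y, hy⟩, rfl⟩
    · rintro ⟨z, rfl⟩
      exact z.2

/-- Generic flatness for all finite modules over `R`. -/
def GFRing (A R : Type u) [CommRing A] [CommRing R] [Algebra A R] : Prop :=
  ∀ (Q : Type u) [AddCommGroup Q] [Module A Q] [Module R Q] [IsScalarTower A R Q],
      Module.Finite R Q → ∃ a : A, a ≠ 0 ∧ GFlat a Q

open Polynomial in
theorem GFRing.poly {A R : Type u} [CommRing A] [IsDomain A] [CommRing R] [IsNoetherianRing R]
    [Algebra A R] (h : GFRing A R) : GFRing A R[X] := by
  intro M _ _ _ _ hfin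
  let _ : Module R M := Module.compHom M (C : R →+* R[X])
  have hsm : ∀ (r : R) (m : M), r • m = (C r : R[X]) • m := fun _ _ => rfl
  have : IsScalarTower A R M := ⟨fun a r m => by
    rw [hsm, hsm, ← smul_assoc, Polynomial.smul_C]⟩
  have : IsScalarTower R R[X] M := ⟨fun a r m => by
    rw [hsm, ← mul_smul, Polynomial.smul_eq_C_mul]⟩
  obtain ⟨s, hs⟩ := hfin.fg_top
  let T : Module.End R M := Algebra.lsmul R R M (X : R[X])
  have hT : ∀ (k : ℕ) m, (T ^ k) m = (X ^ k : R[X]) • m := by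
    intro k m
    simp only [T, ← map_pow]
    rfl
  let N := Submodule.span R (s : Set M)
  have hmono := gfFil_mono T N
  refine gflat_step h T N ⟨s, rfl⟩ fun m => ?_
  have hm : m ∈ Submodule.span R[X] (s : Set M) := hs ▸ Submodule.mem_top
  have hadd : ∀ x y : M, (∃ k, x ∈ gfFil T N k) → (∃ k, y ∈ gfFil T N k) →
      ∃ k, x + y ∈ gfFil T N k := by
    rintro x y ⟨k, hk⟩ ⟨l, hl⟩
    exact ⟨max k l, add_mem (hmono (le_max_left k l) hk) (hmono (le_max_right k l) hl)⟩
  induction hm using Submodule.span_induction with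
  | mem x hx =>
    exact ⟨1, Submodule.mem_sup_right ⟨x, Submodule.subset_span hx, by simp⟩⟩
  | zero => exact ⟨0, zero_mem _⟩
  | add x y _ _ hx hy => exact hadd x y hx hy
  | smul p x _ hx =>
    induction p using Polynomial.induction_on' with
    | add p q hp hq => rw [add_smul]; exact hadd _ _ hp hq
    | monomial n r =>
      obtain ⟨k, hk⟩ := hx
      rw [← Polynomial.C_mul_X_pow_eq_monomial, mul_smul, ← hsm, ← hT]
      refine ⟨k + n, Submodule.smul_mem _ _ ?_⟩
      clear r
      induction n with
      | zero => simpa using hk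
      | succ n ih => 
        rw [pow_succ']
        exact gfFil_map T N _ ⟨_, ih, rfl⟩

theorem GFRing.of_surjective {A R S : Type u} [CommRing A] [CommRing R] [CommRing S]
    [Algebra A R] [Algebra A S] (h : GFRing A R) (f : R →ₐ[A] S) (hf : Function.Surjective f) :
    GFRing A S := by
  intro M _ _ _ _ hfin
  let _ : Module R M := Module.compHom M (f : R →+* S)
  have hsm : ∀ (r : R) (m : M), r • m = f r • m := fun _ _ => rfl
  have : IsScalarTower A R M := ⟨fun a r m => by
    rw [hsm, hsm, ← smul_assoc, map_smul]⟩
  refine h M ?_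
  obtain ⟨s, hs⟩ := hfin.fg_top
  refine ⟨s, ?_⟩
  rw [eq_top_iff]
  rintro m -
  have hm : m ∈ Submodule.span S (s : Set M) := hs ▸ Submodule.mem_top
  induction hm using Submodule.span_induction with
  | mem x hx => exact Submodule.subset_span hx
  | zero => exact zero_mem _
  | add x y _ _ hx hy => exact add_mem hx hy
  | smul p x _ hx =>
    obtain ⟨p, rfl⟩ := hf p
    exact Submodule.smul_mem _ p hx

theorem gf_isLocalizedModule (S : Submonoid A) (I : Ideal A) (f : M →ₗ[A] M')
    [IsLocalizedModule S f] : IsLocalizedModule S (f.lTensor I) := by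
  have h0 : IsLocalizedModule S (f.rTensor I) :=
    IsLocalizedModule.rTensor (R := A) (A := A) (N := I) S f
  have h1 := IsLocalizedModule.of_linearEquiv S (f.rTensor I) (TensorProduct.comm A M' I)
  have h2 := IsLocalizedModule.of_linearEquiv_right S
    ((TensorProduct.comm A M' I).toLinearMap ∘ₗ f.rTensor I) (TensorProduct.comm A I M)
  convert h2
  ext i m
  simp

theorem gflat_iff [IsNoetherianRing A] (a : A) : GFlat a M ↔
    Module.Flat (Localization.Away a) (LocalizedModule (Submonoid.powers a) M) := by
  rw [Module.flat_iff_of_isLocalization (Localization.Away a) (Submonoid.powers a),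
    Module.Flat.iff_lift_lsmul_comp_subtype_injective]
  let ι := LocalizedModule.mkLinearMap (Submonoid.powers a) M
  have hloc (I : Ideal A) := gf_isLocalizedModule (Submonoid.powers a) I ι
  constructor
  · intro h I _
    change Function.Injective (gfMul I _)
    rw [injective_iff_map_eq_zero]
    intro x hx
    obtain ⟨⟨y, s⟩, hy⟩ := IsLocalizedModule.surj (Submonoid.powers a) (ι.lTensor I) x
    have h1 : ι (gfMul I M y) = 0 := by
      rw [← gfMul_lTensor, ← hy, Submonoid.smul_def, map_smul, hx, smul_zero]
    obtain ⟨⟨_, k, rfl⟩, ht⟩ := (IsLocalizedModule.eq_zero_iff (Submonoid.powers a) ι).1 h1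
    simp only [Submonoid.smul_def] at ht
    rw [← map_smul] at ht
    obtain ⟨n, hn⟩ := h I _ ht
    have h2 : ι.lTensor I y = 0 :=
      (IsLocalizedModule.eq_zero_iff (Submonoid.powers a) (ι.lTensor I)).2
        ⟨⟨a ^ (n + k), n + k, rfl⟩, by
          change a ^ (n + k) • y = 0
          rw [pow_add, mul_smul]
          exact hn⟩
    rw [h2] at hy
    exact IsLocalizedModule.smul_injective (ι.lTensor I) s (by simpa using hy)
  · intro h I x hx
    have hinj : Function.Injective (gfMul I (LocalizedModule (Submonoid.powers a) M)) :=
      h (IsNoetherian.noetherian I)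
    have h1 : ι.lTensor I x = 0 := hinj (by rw [gfMul_lTensor, hx, map_zero, map_zero])
    obtain ⟨⟨_, k, rfl⟩, ht⟩ :=
      (IsLocalizedModule.eq_zero_iff (Submonoid.powers a) (ι.lTensor I)).1 h1
    exact ⟨k, ht⟩

theorem GFRing.base (A : Type u) [CommRing A] [IsDomain A] [IsNoetherianRing A] : GFRing A A := by
  intro M _ m1 m2 hst hfin
  have e : m1 = m2 := Module.ext' _ _ fun r m => by
    have := hst.smul_assoc r 1 m
    rw [smul_eq_mul, mul_one] at this
    rw [this, one_smul]
  subst e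
  have := Module.finitePresentation_of_finite A M
  obtain ⟨r, hr, hr', _⟩ := Module.FinitePresentation.exists_free_localizedModule_powers
    (nonZeroDivisors A) (LocalizedModule.mkLinearMap (nonZeroDivisors A) M)
    (FractionRing A)
  exact ⟨r, nonZeroDivisors.ne_zero hr, (gflat_iff r).2 inferInstance⟩

theorem GFRing.mvPolynomial (A : Type u) [CommRing A] [IsDomain A] [IsNoetherianRing A] (n : ℕ) :
    GFRing A (MvPolynomial (Fin n) A) := by
  induction n with
  | zero =>
    exact (GFRing.base A).of_surjective (MvPolynomial.isEmptyAlgEquiv A (Fin 0)).symm.toAlgHom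
      (MvPolynomial.isEmptyAlgEquiv A (Fin 0)).symm.surjective
  | succ n ih =>
    exact ih.poly.of_surjective (MvPolynomial.finSuccEquiv A n).symm.toAlgHom
      (MvPolynomial.finSuccEquiv A n).symm.surjective

end GenericFlatness

/-- **Generic flatness.** Let `A` be a Noetherian commutative integral domain and `B` a
finitely generated commutative `A`-algebra. Then there is a nonzero `a : A` such that the
localization `B_a` (realized as the localized module `B[1/a]`, which coincides with the ring
localization of `B` away from the image of `a`) is flat over `A_a = A[1/a]`. -/
theorem exists_localization_flat {A B : Type u} [CommRing A] [IsDomain A] [IsNoetherianRing A]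
    [CommRing B] [Algebra A B] (hB : Algebra.FiniteType A B) :
    ∃ a : A, a ≠ 0 ∧
      Module.Flat (Localization.Away a) (LocalizedModule (Submonoid.powers a) B) := by
  obtain ⟨n, f, hf⟩ := Algebra.FiniteType.iff_quotient_mvPolynomial''.mp hB
  obtain ⟨a, ha, h⟩ := (GFRing.mvPolynomial A n).of_surjective f hf B inferInstance
  exact ⟨a, ha, (gflat_iff a).1 h⟩
end

section
/- Let A be a commutative ring, B a Noetherian commutative A-algebra, and I an ideal of A, and suppose the structure map A → B is pure. Suppose moreover that the induced morphism Φ from Proj of the Rees algebra R_B(BI) = B[t·IB] to Proj of the Rees algebra R_A(I) = A[tI] is flat. Then Φ is faithfully flat; that is, for every homogeneous prime ideal P of R_A(I) there exists a homogeneous prime Q of R_B(BI), minimal among primes containing P·R_B(BI), whose preimage in R_A(I) equals P. -/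
open Polynomial
open scoped TensorProduct

/-- The natural degree-preserving homomorphism `R_A(I) = A[tI] → R_B(IB) = B[t·IB]` between
Rees algebras induced by the structure map `A → B`, given by mapping coefficients. -/
noncomputable def reesAlgebraMap {A B : Type u} [CommRing A] [CommRing B] [Algebra A B]
    (I : Ideal A) :
    reesAlgebra I →+* reesAlgebra (I.map (algebraMap A B)) :=
  RingHom.codRestrict
    ((Polynomial.mapRingHom (algebraMap A B)).comp (reesAlgebra I).val.toRingHom)
    (reesAlgebra (I.map (algebraMap A B)))
    (fun p => by
      rw [mem_reesAlgebra_iff]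
      intro i
      simp only [RingHom.comp_apply, coe_mapRingHom, AlgHom.toRingHom_eq_coe,
        RingHom.coe_coe, Subalgebra.coe_val, Polynomial.coeff_map]
      rw [← Ideal.map_pow]
      exact Ideal.mem_map_of_mem _ ((mem_reesAlgebra_iff I (p : A[X])).1 p.2 i))

/-- An ideal `J` of the Rees algebra `R_A(I) ⊆ A[t]` is homogeneous if for every `p ∈ J` each
homogeneous component `(coeff n p) tⁿ` of `p` again lies in `J`. -/
def IsHomogeneousReesIdeal {A : Type u} [CommRing A] (I : Ideal A)
    (J : Ideal (reesAlgebra I)) : Prop :=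
  ∀ p ∈ J, ∀ n : ℕ,
    (⟨Polynomial.monomial n ((p : A[X]).coeff n),
      reesAlgebra.monomial_mem.2 ((mem_reesAlgebra_iff I (p : A[X])).1 p.2 n)⟩ :
        reesAlgebra I) ∈ J

/-- The affine chart `C[J/a] ⊆ C_a` of the blow-up `Proj R_C(J) → Spec C` of `Spec C` along the
ideal `J`: the `C`-subalgebra of the localization `C_a` generated by the fractions `x/a` for
`x ∈ J`. -/
def blowUpChart {C : Type u} [CommRing C] (J : Ideal C) (a : C) :
    Subalgebra C (Localization.Away a) :=
  Algebra.adjoin C {y : Localization.Away a | ∃ x ∈ J,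
    y * algebraMap C (Localization.Away a) a = algebraMap C (Localization.Away a) x}

/-- The map of affine charts `A[I/a] → B[(IB)/a]` of the blow-ups along `I` resp. `IB`
induced by `f : A →+* B`; it is the restriction of the localization map `A_a → B_{f a}`. -/
noncomputable def blowUpChartMap {A B : Type u} [CommRing A] [CommRing B] (f : A →+* B)
    (I : Ideal A) (a : A) :
    blowUpChart I a →+* blowUpChart (I.map f) (f a) :=
  RingHom.codRestrict
    ((Localization.awayMap f a).comp (blowUpChart I a).val.toRingHom)
    (blowUpChart (I.map f) (f a))
    (fun y => by
      obtain ⟨y, hy⟩ := y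
      have key : ∀ r : A, Localization.awayMap f a (algebraMap A (Localization.Away a) r) =
          algebraMap B (Localization.Away (f a)) (f r) := fun r =>
        IsLocalization.map_eq _ r
      simp only [RingHom.comp_apply, AlgHom.toRingHom_eq_coe, RingHom.coe_coe,
        Subalgebra.coe_val]
      induction hy using Algebra.adjoin_induction with
      | mem z hz =>
          obtain ⟨x, hxI, hx⟩ := hz
          refine Algebra.subset_adjoin ⟨f x, Ideal.mem_map_of_mem f hxI, ?_⟩
          have h2 := congrArg (Localization.awayMap f a) hx
          rwa [map_mul, key, key] at h2
      | algebraMap r =>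
          rw [key]
          exact Subalgebra.algebraMap_mem _ _
      | add x y hx hy ihx ihy => rw [map_add]; exact add_mem ihx ihy
      | mul x y hx hy ihx ihy => rw [map_mul]; exact mul_mem ihx ihy)

theorem exists_valuationSubring_center {R K : Type u} [CommRing R] [Field K] (P : Ideal R)
    [P.IsPrime] (ψ : R →+* K) (hψ : RingHom.ker ψ ≤ P) :
    ∃ (V : ValuationSubring K) (φ : R →+* V), (∀ r, ((φ r : V) : K) = ψ r) ∧
      (IsLocalRing.maximalIdeal V).comap φ = P := by
  have hu : ∀ y : P.primeCompl, IsUnit (ψ y) := by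
    rintro ⟨y, hy⟩
    rw [isUnit_iff_ne_zero]
    intro h
    exact hy (hψ h)
  let g : Localization.AtPrime P →+* K := IsLocalization.lift (M := P.primeCompl) hu
  have hg : ∀ r, g (algebraMap R _ r) = ψ r := fun r => IsLocalization.lift_eq hu r
  obtain ⟨V, hV, hloc⟩ := (LocalSubring.range g).exists_le_valuationSubring
  have hmem : ∀ r, ψ r ∈ V := fun r => hV ⟨algebraMap R _ r, hg r⟩
  refine ⟨V, ψ.codRestrict V hmem, fun r => rfl, ?_⟩
  ext r
  rw [Ideal.mem_comap, IsLocalRing.mem_maximalIdeal, mem_nonunits_iff]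
  constructor
  · intro h
    by_contra hr
    apply h
    have h1 : IsUnit (algebraMap R (Localization.AtPrime P) r) :=
      IsLocalization.map_units (M := P.primeCompl) _ ⟨r, hr⟩
    obtain ⟨s, hs⟩ := isUnit_iff_exists_inv.1 h1
    have h2 := congrArg g hs
    rw [map_mul, hg, map_one] at h2
    exact isUnit_iff_exists_inv.2 ⟨⟨g s, hV ⟨s, rfl⟩⟩, Subtype.ext h2⟩
  · intro hr h
    have h1 : IsUnit (Subring.inclusion hV ⟨ψ r, ⟨algebraMap R _ r, hg r⟩⟩) := h
    have h2 := hloc.map_nonunit _ h1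
    obtain ⟨⟨_, s, rfl⟩, hs⟩ := isUnit_iff_exists_inv.1 h2
    have h3 : ψ r * g s = 1 := congrArg Subtype.val hs
    obtain ⟨a, b, rfl⟩ := IsLocalization.exists_mk'_eq P.primeCompl s
    have h4 : g (IsLocalization.mk' _ a b) * ψ b = ψ a := by
      rw [← hg, ← map_mul, IsLocalization.mk'_spec, hg]
    have h5 : ψ (r * a - b) = 0 := by
      rw [map_sub, map_mul, ← h4, ← mul_assoc, h3, one_mul, sub_self]
    have h6 : r * a - b ∈ P := hψ h5
    refine b.2 ?_
    have h7 := P.sub_mem (P.mul_mem_right a hr) h6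
    rwa [sub_sub_cancel] at h7

theorem rees_core {A B : Type u} [CommRing A] [CommRing B] [Algebra A B]
    (hpure : ∀ (M : Type u) [AddCommGroup M] [Module A M],
      Function.Injective (fun m : M => (m ⊗ₜ[A] (1 : B) : M ⊗[A] B)))
    (I : Ideal A) (V K : Type u) [CommRing V] [IsDomain V] [ValuationRing V] [Algebra A V]
    [Field K] [Algebra V K] [IsFractionRing V K] (τ : K)
    (φ : reesAlgebra I →+* V)
    (hφ : ∀ r : reesAlgebra I, algebraMap V K (φ r) =
      (r : A[X]).eval₂ ((algebraMap V K).comp (algebraMap A V)) τ)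
    (r : reesAlgebra I)
    (hr : reesAlgebraMap (B := B) I r ∈
      ((IsLocalRing.maximalIdeal V).comap φ).map (reesAlgebraMap (B := B) I)) :
    φ r ∈ IsLocalRing.maximalIdeal V := by
  let T := V ⊗[A] B
  let S := Algebra.algebraMapSubmonoid T (nonZeroDivisors V)
  let L := Localization S
  let j : T →+* L := algebraMap T L
  have hu : ∀ y : nonZeroDivisors V, IsUnit ((j.comp (algebraMap V T)) y) := fun y =>
    IsLocalization.map_units (M := S) L ⟨algebraMap V T y, ⟨y, y.2, rfl⟩⟩
  let κ : K →+* L := IsLocalization.lift (M := nonZeroDivisors V) hu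
  have hκ : ∀ v, κ (algebraMap V K v) = j (algebraMap V T v) := fun v =>
    IsLocalization.lift_eq hu v
  let β : B →+* L := j.comp (Algebra.TensorProduct.includeRight : B →ₐ[A] T).toRingHom
  have hβ : ∀ a : A, β (algebraMap A B a) = κ (algebraMap V K (algebraMap A V a)) := by
    intro a
    rw [hκ]
    change j ((1 : V) ⊗ₜ[A] (algebraMap A B a)) = j ((algebraMap A V a) ⊗ₜ[A] (1 : B))
    rw [Algebra.algebraMap_eq_smul_one (A := B), Algebra.algebraMap_eq_smul_one (A := V),
      TensorProduct.smul_tmul]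
  let g : B[X] →+* L := Polynomial.eval₂RingHom β (κ τ)
  -- compatibility on the Rees algebra of `A`
  have hgA : ∀ s : reesAlgebra I, g (reesAlgebraMap (B := B) I s : B[X]) =
      j (algebraMap V T (φ s)) := by
    intro s
    rw [← hκ, hφ]
    change Polynomial.eval₂ β (κ τ) (Polynomial.map (algebraMap A B) (s : A[X])) = _
    rw [Polynomial.eval₂_map, Polynomial.hom_eval₂]
    congr 1
    ext a
    exact hβ a
  have hmono : ∀ (n : ℕ) (b : B), b ∈ (I.map (algebraMap A B)) ^ n →
      ∃ w : T, g (Polynomial.monomial n b) = j w := by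
    intro n b hb
    rw [← Ideal.map_pow] at hb
    induction hb using Submodule.span_induction with
    | mem x hx =>
      obtain ⟨a, ha, rfl⟩ := hx
      refine ⟨algebraMap V T (φ ⟨Polynomial.monomial n a, reesAlgebra.monomial_mem.2 ha⟩), ?_⟩
      · rw [← hgA]
        congr 1
        change _ = Polynomial.map (algebraMap A B) (Polynomial.monomial n a)
        rw [Polynomial.map_monomial]
    | zero => exact ⟨0, by simp⟩
    | add x y _ _ hx hy =>
      obtain ⟨w, hw⟩ := hx
      obtain ⟨w', hw'⟩ := hy
      exact ⟨w + w', by rw [map_add, map_add, map_add, hw, hw']⟩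
    | smul c x _ hx =>
      obtain ⟨w, hw⟩ := hx
      refine ⟨(Algebra.TensorProduct.includeRight : B →ₐ[A] T) c * w, ?_⟩
      rw [map_mul, ← hw, smul_eq_mul, ← Polynomial.C_mul_monomial, map_mul]
      congr 1
      exact Polynomial.eval₂_C _ _
  have hgB : ∀ s : reesAlgebra (I.map (algebraMap A B)), ∃ w : T, g (s : B[X]) = j w := by
    intro s
    choose w hw using fun n => hmono n _ ((mem_reesAlgebra_iff _ (s : B[X])).1 s.2 n)
    refine ⟨∑ n ∈ (s : B[X]).support, w n, ?_⟩
    conv_lhs => rw [Polynomial.as_sum_support (s : B[X])]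
    rw [map_sum, map_sum]
    exact Finset.sum_congr rfl fun n _ => hw n
  have key : ∀ z ∈ ((IsLocalRing.maximalIdeal V).comap φ).map (reesAlgebraMap (B := B) I),
      ∃ m ∈ IsLocalRing.maximalIdeal V, ∃ w : T, g (z : B[X]) = j (m • w) := by
    intro z hz
    induction hz using Submodule.span_induction with
    | mem x hx =>
      obtain ⟨p, hp, rfl⟩ := hx
      refine ⟨φ p, hp, 1, ?_⟩
      rw [hgA, Algebra.algebraMap_eq_smul_one (A := T)]
    | zero => exact ⟨0, zero_mem _, 0, by simp⟩
    | add x y _ _ hx hy =>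
      obtain ⟨m, hm, w, hw⟩ := hx
      obtain ⟨m', hm', w', hw'⟩ := hy
      have hxy : g ((x + y : reesAlgebra (I.map (algebraMap A B))) : B[X]) =
          j (m • w + m' • w') := by
        rw [map_add, ← hw, ← hw', ← map_add]; rfl
      rcases ValuationRing.dvd_total m m' with ⟨c, rfl⟩ | ⟨c, rfl⟩
      · exact ⟨m, hm, w + c • w', by rw [hxy, smul_add, smul_smul]⟩
      · exact ⟨m', hm', c • w + w', by rw [hxy, smul_add, smul_smul]⟩
    | smul c x _ hx =>
      obtain ⟨m, hm, w, hw⟩ := hx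
      obtain ⟨w', hw'⟩ := hgB c
      refine ⟨m, hm, w' * w, ?_⟩
      have : g ((c • x : reesAlgebra (I.map (algebraMap A B))) : B[X]) =
          g (c : B[X]) * g (x : B[X]) := by rw [← map_mul]; rfl
      rw [this, hw, hw', ← map_mul, mul_smul_comm]
  obtain ⟨m, hm, w, hw⟩ := key _ hr
  rw [hgA] at hw
  obtain ⟨⟨_, c, hc, rfl⟩, hcw⟩ := (IsLocalization.eq_iff_exists S L).1 hw
  have hc0 : c ≠ 0 := nonZeroDivisors.ne_zero hc
  have h1 : algebraMap V T (c * φ r) = (c * m) • w := by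
    rw [map_mul]
    refine hcw.trans ?_
    rw [mul_smul, Algebra.smul_def c]
  let N := V ⧸ Ideal.span {c * m}
  let q : V →ₗ[A] N := (Ideal.Quotient.mkₐ A (Ideal.span {c * m})).toLinearMap
  have h2 : ∀ w : T, (q.rTensor B) ((c * m) • w) = 0 := by
    intro w
    induction w using TensorProduct.induction_on with
    | zero => simp
    | tmul v b =>
      have : q ((c * m) • v) = 0 := by
        change Ideal.Quotient.mk _ _ = 0
        rw [Ideal.Quotient.eq_zero_iff_mem]
        exact Ideal.mul_mem_right _ _ (Ideal.mem_span_singleton_self _)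
      rw [TensorProduct.smul_tmul', LinearMap.rTensor_tmul, this, TensorProduct.zero_tmul]
    | add x y hx hy => rw [smul_add, map_add, hx, hy, add_zero]
  have h3 : q (c * φ r) = 0 := by
    apply hpure N
    have h4 := h2 w
    rw [← h1] at h4
    simp only [TensorProduct.zero_tmul]
    exact h4
  have h5 : c * φ r ∈ Ideal.span {c * m} := by
    rw [← Ideal.Quotient.eq_zero_iff_mem]; exact h3
  obtain ⟨d, hd⟩ := Ideal.mem_span_singleton'.1 h5
  have h6 : φ r = d * m := by
    apply mul_left_cancel₀ hc0
    rw [← hd]; ring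
  rw [h6]
  exact Ideal.mul_mem_left _ _ hm

/-- The homogeneous component of an element of the Rees algebra. -/
noncomputable def reesComponent {B : Type u} [CommRing B] (J : Ideal B) (n : ℕ)
    (p : reesAlgebra J) : reesAlgebra J :=
  ⟨Polynomial.monomial n ((p : B[X]).coeff n),
      reesAlgebra.monomial_mem.2 ((mem_reesAlgebra_iff J (p : B[X])).1 p.2 n)⟩

theorem exists_reesGrading {B : Type u} [CommRing B] (J : Ideal B) :
    ∃ δ : reesAlgebra J →+* (reesAlgebra J)[X],
      ∀ p n, (δ p).coeff n = reesComponent J n p := by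
  let δ₀ : B[X] →+* B[X][X] :=
    Polynomial.eval₂RingHom (Polynomial.C.comp Polynomial.C)
      (Polynomial.C Polynomial.X * Polynomial.X)
  have hδ₀ : ∀ p n, (δ₀ p).coeff n = Polynomial.monomial n (p.coeff n) := by
    intro p n
    induction p using Polynomial.induction_on' with
    | add p q hp hq => rw [map_add, Polynomial.coeff_add, hp, hq, Polynomial.coeff_add, map_add]
    | monomial k b =>
      have : δ₀ (Polynomial.monomial k b) = Polynomial.monomial k (Polynomial.monomial k b) := by
        change Polynomial.eval₂ _ _ _ = _
        rw [Polynomial.eval₂_monomial, mul_pow, ← mul_assoc, ← Polynomial.C_pow,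
          RingHom.comp_apply, ← Polynomial.C_mul, Polynomial.C_mul_X_pow_eq_monomial,
          Polynomial.C_mul_X_pow_eq_monomial]
      rw [this, Polynomial.coeff_monomial, Polynomial.coeff_monomial]
      split_ifs with h
      · rw [h]
      · rw [map_zero]
  let ι : (reesAlgebra J)[X] →+* B[X][X] :=
    Polynomial.mapRingHom (reesAlgebra J).val.toRingHom
  have hι : Function.Injective ι := Polynomial.map_injective _ Subtype.val_injective
  have hex : ∀ p : reesAlgebra J, ∃ P : (reesAlgebra J)[X], ι P = δ₀ p := by
    intro p
    refine ⟨∑ n ∈ (p : B[X]).support, Polynomial.monomial n (reesComponent J n p), ?_⟩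
    ext1 n
    rw [hδ₀, map_sum, Polynomial.finsetSum_coeff]
    have : ∀ k ∈ (p : B[X]).support,
        (ι (Polynomial.monomial k (reesComponent J k p))).coeff n =
          if k = n then Polynomial.monomial k ((p : B[X]).coeff k) else 0 := by
      intro k _
      change (Polynomial.map _ _).coeff n = _
      rw [Polynomial.map_monomial, Polynomial.coeff_monomial]
      rfl
    rw [Finset.sum_congr rfl this, Finset.sum_ite_eq']
    split_ifs with h
    · rfl
    · rw [Polynomial.notMem_support_iff.1 h, map_zero]
  choose d hd using hex
  refine ⟨{ toFun := d, map_one' := ?_, map_mul' := ?_, map_zero' := ?_, map_add' := ?_ }, ?_⟩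
  · apply hι; rw [hd, map_one]; exact map_one δ₀
  · intro x y; apply hι; rw [hd, map_mul, hd, hd]; exact map_mul δ₀ _ _
  · apply hι; rw [hd, map_zero]; exact map_zero δ₀
  · intro x y; apply hι; rw [hd, map_add, hd, hd]; exact map_add δ₀ _ _
  · intro p n
    apply Subtype.ext
    have := congrArg (fun z => Polynomial.coeff z n) (hd p)
    simp only [hδ₀] at this
    refine Eq.trans ?_ this
    change _ = (Polynomial.map _ (d p)).coeff n
    rw [Polynomial.coeff_map]
    rfl

theorem rees_sum_component {B : Type u} [CommRing B] (J : Ideal B) (p : reesAlgebra J) :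
    p = ∑ n ∈ (p : B[X]).support, reesComponent J n p := by
  apply Subtype.ext
  rw [AddSubmonoidClass.coe_finsetSum]
  exact Polynomial.as_sum_support (p : B[X])

/-- Let `A` be a commutative ring, `B` a Noetherian commutative `A`-algebra with pure
structure map (for every `A`-module `M`, `m ↦ m ⊗ 1 : M → M ⊗[A] B` is injective), and `I` an
ideal of `A`. Suppose the induced morphism `Φ : Proj R_B(IB) → Proj R_A(I)` of blow-ups is
flat (on each affine chart `a ∈ I`, the induced map `A[I/a] → B[(IB)/a]` is flat). Then `Φ` is
faithfully flat: for every homogeneous prime ideal `P` of `R_A(I)` there exists a homogeneous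
prime `Q` of `R_B(IB)`, minimal among primes containing `P·R_B(IB)`, whose preimage in
`R_A(I)` equals `P`. -/
theorem rees_blowUp_faithfullyFlat {A B : Type u} [CommRing A] [CommRing B] [Algebra A B]
    [IsNoetherianRing B]
    (hpure : ∀ (M : Type u) [AddCommGroup M] [Module A M],
      Function.Injective (fun m : M => (m ⊗ₜ[A] (1 : B) : M ⊗[A] B)))
    (I : Ideal A)
    (hΦflat : ∀ a ∈ I, (blowUpChartMap (algebraMap A B) I a).Flat)
    (P : Ideal (reesAlgebra I)) (hP : P.IsPrime) (hPhom : IsHomogeneousReesIdeal I P) :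
    ∃ Q ∈ (P.map (reesAlgebraMap (B := B) I)).minimalPrimes,
      IsHomogeneousReesIdeal (I.map (algebraMap A B)) Q ∧
        Q.comap (reesAlgebraMap (B := B) I) = P := by
  haveI := hP
  let f := reesAlgebraMap (B := B) I
  -- some prime of `R_B` lies over `P`
  have hcm : (P.map f).comap f = P := by
    refine le_antisymm ?_ Ideal.le_comap_map
    obtain ⟨p₀, hp₀, hp₀P⟩ := Ideal.exists_minimalPrimes_le (I := ⊥) (J := P) bot_le
    obtain ⟨q, hq, hqp⟩ := Ideal.exists_comap_eq_of_mem_minimalPrimes_of_injective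
      (f := (reesAlgebra I).val.toRingHom) Subtype.val_injective p₀ hp₀
    let K := FractionRing (A[X] ⧸ q)
    let ψ : A[X] →+* K := (algebraMap (A[X] ⧸ q) K).comp (Ideal.Quotient.mk q)
    have hker : ∀ x, ψ x = 0 → x ∈ q := by
      intro x hx
      rw [← Ideal.Quotient.eq_zero_iff_mem]
      exact (map_eq_zero_iff _ (IsFractionRing.injective (A[X] ⧸ q) K)).1 hx
    obtain ⟨V, φ, hφ, hφP⟩ := exists_valuationSubring_center P
      (ψ.comp (reesAlgebra I).val.toRingHom) (fun x hx => hp₀P (by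
        rw [← hqp]
        exact hker _ hx))
    letI : Algebra A V := (φ.comp (algebraMap A (reesAlgebra I))).toAlgebra
    intro r hr
    rw [← hφP]
    refine rees_core (B := B) hpure I V K (ψ Polynomial.X) φ ?_ r ?_
    · intro s
      refine (hφ s).trans ?_
      change ψ (s : A[X]) = _
      conv_lhs => rw [← Polynomial.eval₂_C_X (p := (s : A[X])), Polynomial.hom_eval₂]
      congr 1
      ext a
      exact (hφ (algebraMap A (reesAlgebra I) a)).symm
    · rw [hφP]; exact hr
  obtain ⟨Q', hQ', hQ'P⟩ := (Ideal.comap_map_eq_self_iff_of_isPrime P).1 hcm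
  obtain ⟨Q, hQ, hQQ'⟩ := Ideal.exists_minimalPrimes_le (I := P.map f) (J := Q')
    (Ideal.map_le_iff_le_comap.2 hQ'P.ge)
  have hQprime : Q.IsPrime := hQ.1.1
  refine ⟨Q, hQ, ?_, ?_⟩
  · obtain ⟨δ, hδ⟩ := exists_reesGrading (I.map (algebraMap A B))
    let Qs := (Q.map (Polynomial.C : _ →+* (reesAlgebra (I.map (algebraMap A B)))[X])).comap δ
    have hmem : ∀ x, x ∈ Qs ↔ ∀ n, reesComponent _ n x ∈ Q := by
      intro x
      rw [Ideal.mem_comap, Ideal.mem_map_C_iff]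
      simp only [hδ]
    have hQs : Qs.IsPrime := Ideal.comap_isPrime _ _
    have hle : Qs ≤ Q := by
      intro x hx
      rw [rees_sum_component _ x]
      exact Ideal.sum_mem _ fun n _ => (hmem x).1 hx n
    have hPQs : P.map f ≤ Qs := by
      rw [Ideal.map_le_iff_le_comap]
      intro p hp
      rw [Ideal.mem_comap, hmem]
      intro n
      have : reesComponent _ n (f p) = f (reesComponent I n p) := by
        apply Subtype.ext
        change Polynomial.monomial n ((Polynomial.map (algebraMap A B) (p : A[X])).coeff n) =
          Polynomial.map (algebraMap A B) (Polynomial.monomial n ((p : A[X]).coeff n))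
        rw [Polynomial.coeff_map, Polynomial.map_monomial]
      rw [this]
      exact hQ.1.2 (Ideal.mem_map_of_mem f (hPhom p hp n))
    intro p hp n
    exact (hmem p).1 (hQ.2 ⟨hQs, hPQs⟩ hle hp) n
  · refine le_antisymm ?_ ?_
    · rw [← hQ'P]; exact Ideal.comap_mono hQQ'
    · exact Ideal.map_le_iff_le_comap.1 hQ.1.2
end
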